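/- Let M be a tempered weight on ℝ^{4d} and let N : ((ℤ^d×ℤ^d)²)² → ℂ, written N_{(α̃,β̃),(γ̃,δ̃)}, satisfy: for every n ∈ ℕ, sup over all indices of ⟨(α̃,β̃)−(γ̃,δ̃)⟩^n · M(((α̃,β̃)+(γ̃,δ̃))/2)^{-1} · |N_{(α̃,β̃),(γ̃,δ̃)}| is finite. Then the series Σ_{(α̃,β̃),(γ̃,δ̃)} N_{(α̃,β̃),(γ̃,δ̃)} · g_{α̃,γ̃}(X_L) · g_{δ̃,β̃}(X_R), as a function of (X_L,X_R) ∈ ℝ^{2d}×ℝ^{2d} = ℝ^{4d}, converges uniformly on compact subsets of ℝ^{4d} (along the net of finite partial sums), as do all term-wise partial derivatives; the limit Φ is smooth and belongs to S₀(M), i.e. sup_X M(X)^{-1}|∂^ωΦ(X)| < ∞ for every multi-index ω; and for every k ∈ ℕ there exist C > 0 and n ∈ ℕ such that ‖Φ‖_{S₀(M),k} ≤ C · sup over all indices of ⟨(α̃,β̃)−(γ̃,δ̃)⟩^n · M(((α̃,β̃)+(γ̃,δ̃))/2)^{-1} · |N_{(α̃,β̃),(γ̃,δ̃)}|. -/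

import Mathlib

open MeasureTheory Filter
open scoped ENNReal

noncomputable section

/-- Japanese bracket `⟨v⟩ = √(1+‖v‖²)` with the Euclidean norm on `ℝ^N`. -/
def jbV {N : ℕ} (v : Fin N → ℝ) : ℝ := Real.sqrt (1 + ∑ i, v i ^ 2)

/-- A tempered weight on `ℝ^N`: a positive function `m` with
`m(u+v) ≤ C·m(u)·⟨v⟩^a` for some `C, a > 0`. -/
def IsTemperedWeight {N : ℕ} (m : (Fin N → ℝ) → ℝ) : Prop :=
  (∀ u, 0 < m u) ∧ ∃ C > 0, ∃ a : ℝ, 0 < a ∧ ∀ u v, m (u + v) ≤ C * m u * jbV v ^ a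

/-- A regular magnetic field on `ℝ^d`: smooth, antisymmetric, closed, with all
derivatives of all components bounded. -/
structure IsRegularMagneticField (d : ℕ) (B : Fin d → Fin d → (Fin d → ℝ) → ℝ) : Prop where
  smooth : ∀ j k, ContDiff ℝ (⊤ : ℕ∞) (B j k)
  antisymm : ∀ j k x, B j k x = - B k j x
  closed : ∀ i j k, ∀ x : Fin d → ℝ,
      fderiv ℝ (B j k) x (Pi.single i 1) + fderiv ℝ (B k i) x (Pi.single j 1)
        + fderiv ℝ (B i j) x (Pi.single k 1) = 0
  derivBounded : ∀ j k, ∀ n : ℕ, ∃ C : ℝ, ∀ x, ‖iteratedFDeriv ℝ n (B j k) x‖ ≤ C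

/-- The transversal-gauge vector potential based at `y`:
`A_k(x;y) = Σ_j ∫₀¹ s·(x_j−y_j)·B_{jk}(y+s(x−y)) ds`. -/
def magA (d : ℕ) (B : Fin d → Fin d → (Fin d → ℝ) → ℝ) (y x : Fin d → ℝ) (k : Fin d) : ℝ :=
  ∑ j, ∫ s in (0:ℝ)..1, s * (x j - y j) * B j k (y + s • (x - y))

/-- The circulation `φ(x,y) = Σ_k ∫₀¹ A_k(y+s(x−y))·(x_k−y_k) ds` of `A = A(·;0)`
along the segment from `y` to `x`. -/
def magPhi (d : ℕ) (B : Fin d → Fin d → (Fin d → ℝ) → ℝ) (x y : Fin d → ℝ) : ℝ :=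
  ∑ k, ∫ s in (0:ℝ)..1, magA d B 0 (y + s • (x - y)) k * (x k - y k)

/-- A window function for the magnetic Gabor frame: smooth, compactly supported in
`(−1,1)^d`, with `Σ_{α∈ℤ^d} 𝔤(x−α)² = 1`. -/
structure IsWindow (d : ℕ) (g : (Fin d → ℝ) → ℝ) : Prop where
  smooth : ContDiff ℝ (⊤ : ℕ∞) g
  compactSupport : HasCompactSupport g
  support_subset : ∀ x : Fin d → ℝ, g x ≠ 0 → ∀ i, |x i| < 1
  partition : ∀ x : Fin d → ℝ, ∑' α : Fin d → ℤ, (g (x - fun i => (α i : ℝ))) ^ 2 = 1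

abbrev Idx (d : ℕ) := (Fin d → ℤ) × (Fin d → ℤ)
abbrev Idx2 (d : ℕ) := Idx d × Idx d
abbrev E1 (d : ℕ) := Fin d → ℝ
abbrev E2 (d : ℕ) := E1 d × E1 d
abbrev E4 (d : ℕ) := E2 d × E2 d

/-- The magnetic Gabor function
`𝒢_α̃(x) = (2π)^{−d/2}·e^{iφ(x,α)}·𝔤(x−α)·e^{iα'·(x−α)}` for `α̃ = (α,α')`. -/
def gabor (d : ℕ) (B : Fin d → Fin d → E1 d → ℝ) (g : E1 d → ℝ) (a : Idx d) (x : E1 d) : ℂ :=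
  (((2 * Real.pi) ^ (-(d : ℝ) / 2) : ℝ) : ℂ) *
    Complex.exp (Complex.I * (magPhi d B x (fun i => (a.1 i : ℝ)) : ℂ)) *
    ((g (x - fun i => (a.1 i : ℝ)) : ℝ) : ℂ) *
    Complex.exp (Complex.I * ((∑ i, (a.2 i : ℝ) * (x i - (a.1 i : ℝ)) : ℝ) : ℂ))

/-- `G_{α̃,β̃}(x,y) = 𝒢_α̃(x)·conj(𝒢_β̃(y))`. -/
def gaborTensor (d : ℕ) (B : Fin d → Fin d → E1 d → ℝ) (g : E1 d → ℝ) (a b : Idx d)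
    (p : E2 d) : ℂ :=
  gabor d B g a p.1 * (starRingEnd ℂ) (gabor d B g b p.2)

/-- `T_{α̃,β̃}(x,y) = conj(𝒢_α̃(x))·𝒢_β̃(y)`. -/
def gaborDual (d : ℕ) (B : Fin d → Fin d → E1 d → ℝ) (g : E1 d → ℝ) (a b : Idx d)
    (p : E2 d) : ℂ :=
  (starRingEnd ℂ) (gabor d B g a p.1) * gabor d B g b p.2

/-- The frame coefficient `c_{α̃,β̃}(F) = ∫ F(x,y)·conj(𝒢_α̃(x))·𝒢_β̃(y) dx dy`. -/
def frameCoef (d : ℕ) (B : Fin d → Fin d → E1 d → ℝ) (g : E1 d → ℝ) (a b : Idx d)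
    (F : E2 d → ℂ) : ℂ :=
  ∫ p : E2 d, F p * (starRingEnd ℂ) (gabor d B g a p.1) * gabor d B g b p.2

/-- `⟨(α̃,β̃)⟩` with `(α̃,β̃)` regarded as a point of `ℝ^{4d}`. -/
def jbIdxPair (d : ℕ) (a b : Idx d) : ℝ :=
  Real.sqrt (1 + (∑ i, ((a.1 i : ℝ)) ^ 2) + (∑ i, ((a.2 i : ℝ)) ^ 2)
    + (∑ i, ((b.1 i : ℝ)) ^ 2) + ∑ i, ((b.2 i : ℝ)) ^ 2)

/-- Euclidean Japanese bracket on `ℝ^{4d} = E4 d`. -/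
def jbE4 (d : ℕ) (v : E4 d) : ℝ :=
  Real.sqrt (1 + (∑ i, v.1.1 i ^ 2) + (∑ i, v.1.2 i ^ 2) + (∑ i, v.2.1 i ^ 2) + ∑ i, v.2.2 i ^ 2)

/-- A tempered weight on `ℝ^{4d}`. -/
def IsTemperedWeightE4 (d : ℕ) (M : E4 d → ℝ) : Prop :=
  (∀ u, 0 < M u) ∧ ∃ C > 0, ∃ a : ℝ, 0 < a ∧ ∀ u v, M (u + v) ≤ C * M u * jbE4 d v ^ a

/-- Euclidean Japanese bracket on `ℝ^N × ℝ^N`. -/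
def jbP {N : ℕ} (v : (Fin N → ℝ) × (Fin N → ℝ)) : ℝ :=
  Real.sqrt (1 + (∑ i, v.1 i ^ 2) + ∑ i, v.2 i ^ 2)

/-- A tempered weight on `ℝ^N × ℝ^N ≅ ℝ^{2N}`. -/
def IsTemperedWeightProd {N : ℕ} (m : (Fin N → ℝ) × (Fin N → ℝ) → ℝ) : Prop :=
  (∀ u, 0 < m u) ∧ ∃ C > 0, ∃ a : ℝ, 0 < a ∧ ∀ u v, m (u + v) ≤ C * m u * jbP v ^ a

/-- `⟨(α̃,β̃) − (γ̃,δ̃)⟩` for pairs of indices in `ℤ^{2d} × ℤ^{2d}`. -/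
def jbDiffIdx2 (d : ℕ) (p q : Idx2 d) : ℝ :=
  Real.sqrt (1 + (∑ i, ((p.1.1 i - q.1.1 i : ℤ) : ℝ) ^ 2) + (∑ i, ((p.1.2 i - q.1.2 i : ℤ) : ℝ) ^ 2)
    + (∑ i, ((p.2.1 i - q.2.1 i : ℤ) : ℝ) ^ 2) + ∑ i, ((p.2.2 i - q.2.2 i : ℤ) : ℝ) ^ 2)

/-- The midpoint `((α̃,β̃)+(γ̃,δ̃))/2 ∈ ℝ^{4d}`. -/
def midIdx2 (d : ℕ) (p q : Idx2 d) : E4 d :=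
  ((fun i => ((p.1.1 i + q.1.1 i : ℤ) : ℝ) / 2, fun i => ((p.1.2 i + q.1.2 i : ℤ) : ℝ) / 2),
   (fun i => ((p.2.1 i + q.2.1 i : ℤ) : ℝ) / 2, fun i => ((p.2.2 i + q.2.2 i : ℤ) : ℝ) / 2))

/-- Membership in the Hörmander class `S₀(M)` on `ℝ^{4d}`: smooth, with all
derivatives dominated by `M`. -/
def InS0 (d : ℕ) (M : E4 d → ℝ) (Φ : E4 d → ℂ) : Prop :=
  ContDiff ℝ (⊤ : ℕ∞) Φ ∧ ∀ n : ℕ, ∃ C : ℝ, ∀ X, ‖iteratedFDeriv ℝ n Φ X‖ ≤ C * M X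

/-- The seminorms `‖Φ‖_{S₀(M),k}`. -/
def s0Seminorm (d : ℕ) (M : E4 d → ℝ) (k : ℕ) (Φ : E4 d → ℂ) : ℝ :=
  ∑ n ∈ Finset.range (k + 1), ⨆ X : E4 d, ‖iteratedFDeriv ℝ n Φ X‖ / M X

/-- The integrand of the inner (oscillatory) integral defining `H_{(α̃,β̃),(γ̃,δ̃)}`,
evaluated at `X = ((v_L,ξ_L),(v_R,ξ_R))` and `z = (z_L,z_R)`. -/
def gaborKernel4 (d : ℕ) (B : Fin d → Fin d → E1 d → ℝ) (g : E1 d → ℝ) (ab gd : Idx2 d)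
    (X : E4 d) (z : E2 d) : ℂ :=
  Complex.exp (Complex.I * (((∑ i, X.1.2 i * z.1 i) - ∑ i, X.2.2 i * z.2 i : ℝ) : ℂ)) *
  Complex.exp (Complex.I * ((magPhi d B (X.1.1 + (2 : ℝ)⁻¹ • z.1) (X.1.1 - (2 : ℝ)⁻¹ • z.1)
      - magPhi d B (X.2.1 + (2 : ℝ)⁻¹ • z.2) (X.2.1 - (2 : ℝ)⁻¹ • z.2) : ℝ) : ℂ)) *
  gabor d B g gd.1 (X.1.1 + (2 : ℝ)⁻¹ • z.1) *
  (starRingEnd ℂ) (gabor d B g gd.2 (X.2.1 + (2 : ℝ)⁻¹ • z.2)) *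
  (starRingEnd ℂ) (gabor d B g ab.1 (X.1.1 - (2 : ℝ)⁻¹ • z.1)) *
  gabor d B g ab.2 (X.2.1 - (2 : ℝ)⁻¹ • z.2)

/-- The kernel `H_{(α̃,β̃),(γ̃,δ̃)}` on `ℝ^{4d}`. -/
def matH (d : ℕ) (B : Fin d → Fin d → E1 d → ℝ) (g : E1 d → ℝ) (ab gd : Idx2 d)
    (X : E4 d) : ℂ :=
  (((2 * Real.pi) ^ (-(2 * (d : ℝ))) : ℝ) : ℂ) * ∫ z : E2 d, gaborKernel4 d B g ab gd X z

/-- The matrix element `𝕄_{(α̃,β̃),(γ̃,δ̃)}[Φ] = ∫ Φ·H_{(α̃,β̃),(γ̃,δ̃)}`. -/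
def matElem (d : ℕ) (B : Fin d → Fin d → E1 d → ℝ) (g : E1 d → ℝ) (Φ : E4 d → ℂ)
    (ab gd : Idx2 d) : ℂ :=
  ∫ X : E4 d, Φ X * matH d B g ab gd X

/-- The dequantized frame symbol
`g_{α̃,γ̃}(v,ξ) = ∫ e^{−iξ·z}·e^{−iφ(v+z/2,v−z/2)}·𝒢_α̃(v+z/2)·conj(𝒢_γ̃(v−z/2)) dz`. -/
def deqSymbol (d : ℕ) (B : Fin d → Fin d → E1 d → ℝ) (g : E1 d → ℝ) (ac : Idx d × Idx d)
    (vξ : E2 d) : ℂ :=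
  ∫ z : E1 d,
    Complex.exp (-Complex.I * ((∑ i, vξ.2 i * z i : ℝ) : ℂ)) *
    Complex.exp (-Complex.I * ((magPhi d B (vξ.1 + (2 : ℝ)⁻¹ • z) (vξ.1 - (2 : ℝ)⁻¹ • z) : ℝ) : ℂ)) *
    gabor d B g ac.1 (vξ.1 + (2 : ℝ)⁻¹ • z) *
    (starRingEnd ℂ) (gabor d B g ac.2 (vξ.1 - (2 : ℝ)⁻¹ • z))

section ParametricIntegral

theorem norm_iteratedFDeriv_comp_prodMk_le {X Y F : Type} [NormedAddCommGroup X]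
    [NormedSpace ℝ X] [NormedAddCommGroup Y] [NormedSpace ℝ Y] [NormedAddCommGroup F]
    [NormedSpace ℝ F] {G : X × Y → F} (hG : ContDiff ℝ (⊤ : ℕ∞) G) (k : ℕ) (x : X) (y : Y) :
    ‖iteratedFDeriv ℝ k (fun x ↦ G (x, y)) x‖ ≤ ‖iteratedFDeriv ℝ k G (x, y)‖ := by
  have h : (fun x ↦ G (x, y)) = (fun z ↦ G (z + (0, y))) ∘ ContinuousLinearMap.inl ℝ X Y := by
    funext x; simp
  have hG' : ContDiff ℝ (⊤ : ℕ∞) fun z ↦ G (z + (0, y)) := hG.comp (by fun_prop)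
  rw [h, ContinuousLinearMap.iteratedFDeriv_comp_right _ hG' x (by exact_mod_cast le_top),
    iteratedFDeriv_comp_add_right]
  refine (ContinuousMultilinearMap.norm_compContinuousLinearMap_le _ _).trans ?_
  rw [ContinuousLinearMap.inl_apply, Prod.mk_add_mk, add_zero, zero_add]
  refine mul_le_of_le_one_right (norm_nonneg _) ?_
  exact Finset.prod_le_one (fun _ _ ↦ norm_nonneg _)
    fun _ _ ↦ ContinuousLinearMap.norm_inl_le_one ℝ X Y

variable {X Y F : Type} [NormedAddCommGroup X] [NormedSpace ℝ X] [ProperSpace X]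
  [NormedAddCommGroup Y] [NormedSpace ℝ Y] [MeasurableSpace Y] [BorelSpace Y]
  [SecondCountableTopology Y] [NormedAddCommGroup F] [NormedSpace ℝ F]
  {μ : Measure Y} [IsFiniteMeasureOnCompacts μ] {K : Set Y}

theorem hasFDerivAt_setIntegral_of_contDiff (hK : IsCompact K) {G : X × Y → F}
    (hG : ContDiff ℝ 1 G) (x₀ : X) :
    HasFDerivAt (fun x ↦ ∫ y in K, G (x, y) ∂μ)
      (∫ y in K, (fderiv ℝ G (x₀, y)).comp (ContinuousLinearMap.inl ℝ X Y) ∂μ) x₀ := by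
  have hcont : Continuous fun z : X × Y ↦
      (fderiv ℝ G z).comp (ContinuousLinearMap.inl ℝ X Y) :=
    (hG.continuous_fderiv (by simp)).clm_comp continuous_const
  obtain ⟨C, hC⟩ := ((isCompact_closedBall x₀ 1).prod hK).exists_bound_of_continuousOn
    hcont.continuousOn
  have hfin : IsFiniteMeasure (μ.restrict K) := ⟨by simpa using hK.measure_lt_top⟩
  refine hasFDerivAt_integral_of_dominated_of_fderiv_le (𝕜 := ℝ) (bound := fun _ ↦ C)
    (F := fun x y ↦ G (x, y)) (F' := fun x y ↦ (fderiv ℝ G (x, y)).comp (.inl ℝ X Y))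
    (Metric.closedBall_mem_nhds x₀ one_pos) ?_ ?_ ?_ ?_ ?_ ?_
  · exact Eventually.of_forall fun x ↦
      (hG.continuous.comp (by fun_prop : Continuous fun y : Y ↦ (x, y))).aestronglyMeasurable
  · exact (hG.continuous.comp
      (by fun_prop : Continuous fun y : Y ↦ (x₀, y))).continuousOn.integrableOn_compact hK
  · exact (hcont.comp (by fun_prop : Continuous fun y : Y ↦ (x₀, y))).aestronglyMeasurable
  · filter_upwards [ae_restrict_mem hK.measurableSet] with y hy x hx using hC (x, y) ⟨hx, hy⟩
  · exact integrable_const C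
  · refine Eventually.of_forall fun y x _ ↦ ?_
    have h1 := ((hG.differentiable (by simp)) (x, y)).hasFDerivAt
    exact h1.comp x (hasFDerivAt_prodMk_left x y)

theorem contDiff_setIntegral_aux (hK : IsCompact K) (k : ℕ) :
    ∀ {F : Type} [NormedAddCommGroup F] [NormedSpace ℝ F] {G : X × Y → F},
      ContDiff ℝ (⊤ : ℕ∞) G →
      ContDiff ℝ k (fun x ↦ ∫ y in K, G (x, y) ∂μ) ∧
      ∀ (x : X) (C : ℝ), (∀ y ∈ K, ‖iteratedFDeriv ℝ k (fun x ↦ G (x, y)) x‖ ≤ C) →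
        ‖iteratedFDeriv ℝ k (fun x ↦ ∫ y in K, G (x, y) ∂μ) x‖ ≤ C * μ.real K := by
  induction k with
  | zero =>
    intro F _ _ G hG
    refine ⟨?_, fun x C hC ↦ ?_⟩
    · refine contDiff_zero.2 (continuous_iff_continuousAt.2 fun x ↦ ?_)
      exact (hasFDerivAt_setIntegral_of_contDiff hK (hG.of_le (by simp)) x).continuousAt
    · simp only [norm_iteratedFDeriv_zero] at hC ⊢
      exact norm_setIntegral_le_of_norm_le_const hK.measure_lt_top hC
  | succ k ih =>
    intro F _ _ G hG
    have hd := fun x ↦ hasFDerivAt_setIntegral_of_contDiff (μ := μ) hK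
      (hG.of_le (by simp) : ContDiff ℝ 1 G) x
    have hG' : ContDiff ℝ (⊤ : ℕ∞) fun z : X × Y ↦
        (fderiv ℝ G z).comp (ContinuousLinearMap.inl ℝ X Y) :=
      (hG.fderiv_right (by simp)).clm_comp contDiff_const
    have hfd : fderiv ℝ (fun x ↦ ∫ y in K, G (x, y) ∂μ) = fun x ↦
        ∫ y in K, (fderiv ℝ G (x, y)).comp (ContinuousLinearMap.inl ℝ X Y) ∂μ :=
      funext fun x ↦ (hd x).fderiv
    obtain ⟨ih1, ih2⟩ := ih hG'
    refine ⟨?_, fun x C hC ↦ ?_⟩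
    · push_cast
      rw [contDiff_succ_iff_fderiv]
      refine ⟨fun x ↦ (hd x).differentiableAt, by simp, ?_⟩
      rw [hfd]; exact ih1
    · rw [← norm_iteratedFDeriv_fderiv, hfd]
      refine ih2 x C fun y hy ↦ ?_
      have hfy : (fun x ↦ (fderiv ℝ G (x, y)).comp (ContinuousLinearMap.inl ℝ X Y)) =
          fderiv ℝ fun x ↦ G (x, y) := funext fun x ↦
        (HasFDerivAt.comp (g := G) x ((hG.differentiable (by simp)) (x, y)).hasFDerivAt
          (hasFDerivAt_prodMk_left (𝕜 := ℝ) x y)).fderiv.symm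
      rw [hfy, norm_iteratedFDeriv_fderiv]
      exact hC y hy

theorem contDiff_setIntegral (hK : IsCompact K) {G : X × Y → F} (hG : ContDiff ℝ (⊤ : ℕ∞) G) :
    ContDiff ℝ (⊤ : ℕ∞) fun x ↦ ∫ y in K, G (x, y) ∂μ :=
  contDiff_infty.2 fun k ↦ (contDiff_setIntegral_aux hK k hG).1

theorem norm_iteratedFDeriv_setIntegral_le (hK : IsCompact K) {G : X × Y → F}
    (hG : ContDiff ℝ (⊤ : ℕ∞) G) {k : ℕ} {x : X} {C : ℝ}
    (hC : ∀ y ∈ K, ‖iteratedFDeriv ℝ k (fun x ↦ G (x, y)) x‖ ≤ C) :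
    ‖iteratedFDeriv ℝ k (fun x ↦ ∫ y in K, G (x, y) ∂μ) x‖ ≤ C * μ.real K :=
  (contDiff_setIntegral_aux hK k hG).2 x C hC

end ParametricIntegral

/-- A family of smooth functions whose derivatives grow polynomially, uniformly in the index up to
powers of the weight `ρ`. -/
structure UniformTemperate {Λ E F : Type} [NormedAddCommGroup E] [NormedSpace ℝ E]
    [NormedAddCommGroup F] [NormedSpace ℝ F] (ρ : Λ → ℝ) (f : Λ → E → F) : Prop where
  smooth : ∀ l, ContDiff ℝ (⊤ : ℕ∞) (f l)
  bound : ∀ k : ℕ, ∃ (C : ℝ) (p : ℕ), ∀ l z,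
    ‖iteratedFDeriv ℝ k (f l) z‖ ≤ C * (ρ l * (1 + ‖z‖)) ^ p

namespace UniformTemperate

theorem one_le_weight {Λ E : Type} [NormedAddCommGroup E] {ρ : Λ → ℝ}
    (hρ : ∀ l, 1 ≤ ρ l) (l : Λ) (z : E) : 1 ≤ ρ l * (1 + ‖z‖) :=
  one_le_mul_of_one_le_of_one_le (hρ l) (le_add_of_nonneg_right (norm_nonneg z))

variable {Λ D E F G : Type} [NormedAddCommGroup D] [NormedSpace ℝ D]
  [NormedAddCommGroup E] [NormedSpace ℝ E] [NormedAddCommGroup F] [NormedSpace ℝ F]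
  [NormedAddCommGroup G] [NormedSpace ℝ G] {ρ : Λ → ℝ}

theorem bound_uniform (hρ : ∀ l, 1 ≤ ρ l) {f : Λ → E → F} (hf : UniformTemperate ρ f) (n : ℕ) :
    ∃ (C : ℝ) (p : ℕ), 1 ≤ C ∧ 1 ≤ p ∧ ∀ k ≤ n, ∀ l z,
      ‖iteratedFDeriv ℝ k (f l) z‖ ≤ C * (ρ l * (1 + ‖z‖)) ^ p := by
  choose C p h using hf.bound
  have hC : ∀ k, 0 ≤ ∑ i ∈ Finset.range k, |C i| := fun k ↦
    Finset.sum_nonneg fun i _ ↦ abs_nonneg _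
  refine ⟨1 + ∑ i ∈ Finset.range (n + 1), |C i|, 1 + ∑ i ∈ Finset.range (n + 1), p i,
    le_add_of_nonneg_right (hC _), le_self_add, fun k hk l z ↦ (h k l z).trans ?_⟩
  have hk' : k ∈ Finset.range (n + 1) := by simpa [Nat.lt_succ_iff] using hk
  have h1 : C k ≤ 1 + ∑ i ∈ Finset.range (n + 1), |C i| := by
    have := Finset.single_le_sum (f := fun i ↦ |C i|) (fun i _ ↦ abs_nonneg _) hk'
    have := le_abs_self (C k)
    linarith
  have h2 : p k ≤ 1 + ∑ i ∈ Finset.range (n + 1), p i :=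
    (Finset.single_le_sum (f := p) (fun i _ ↦ Nat.zero_le _) hk').trans le_add_self
  have hw := one_le_weight hρ l z
  calc C k * (ρ l * (1 + ‖z‖)) ^ p k
      ≤ (1 + ∑ i ∈ Finset.range (n + 1), |C i|) * (ρ l * (1 + ‖z‖)) ^ p k := by gcongr
    _ ≤ _ := by
      have := hC (n + 1)
      gcongr

theorem of_hasTemperateGrowth (hρ : ∀ l, 1 ≤ ρ l) {f : E → F} (hf : f.HasTemperateGrowth) :
    UniformTemperate ρ fun _ ↦ f := by
  refine ⟨fun _ ↦ hf.1, fun k ↦ ?_⟩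
  obtain ⟨p, C, hC⟩ := hf.2 k
  refine ⟨|C|, p, fun l z ↦ (hC z).trans ?_⟩
  have h1 : 1 + ‖z‖ ≤ ρ l * (1 + ‖z‖) := le_mul_of_one_le_left (by positivity) (hρ l)
  gcongr
  exact le_abs_self C

theorem of_bounded {f : Λ → E → F} (hf : ∀ l, ContDiff ℝ (⊤ : ℕ∞) (f l))
    (hb : ∀ k : ℕ, ∃ C : ℝ, ∀ l z, ‖iteratedFDeriv ℝ k (f l) z‖ ≤ C) :
    UniformTemperate ρ f :=
  ⟨hf, fun k ↦ (hb k).imp fun C hC ↦ ⟨0, fun l z ↦ by simpa using hC l z⟩⟩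

theorem const_of_le (hρ : ∀ l, 1 ≤ ρ l) {c : Λ → F} (hc : ∀ l, ‖c l‖ ≤ ρ l) :
    UniformTemperate ρ fun l (_ : E) ↦ c l := by
  refine ⟨fun _ ↦ contDiff_const, fun k ↦ ⟨1, 1, fun l z ↦ ?_⟩⟩
  have h1 : ρ l ≤ ρ l * (1 + ‖z‖) :=
    le_mul_of_one_le_right (zero_le_one.trans (hρ l)) (by simp)
  rcases Nat.eq_zero_or_pos k with rfl | hk
  · simpa using (hc l).trans h1
  · rw [iteratedFDeriv_const_of_ne hk.ne']
    simpa using zero_le_one.trans (one_le_weight hρ l z)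

theorem comp (hρ : ∀ l, 1 ≤ ρ l) {g : Λ → E → F} {f : Λ → D → E} (hg : UniformTemperate ρ g)
    (hf : UniformTemperate ρ f) : UniformTemperate ρ fun l z ↦ g l (f l z) := by
  refine ⟨fun l ↦ (hg.smooth l).comp (hf.smooth l), fun k ↦ ?_⟩
  obtain ⟨C, p, hC, hp, hg'⟩ := hg.bound_uniform hρ k
  obtain ⟨C', p', hC', hp', hf'⟩ := hf.bound_uniform hρ k
  refine ⟨k.factorial * (C * (2 * C') ^ p) * C' ^ k, (1 + p') * p + p' * k, fun l z ↦ ?_⟩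
  set R := ρ l * (1 + ‖z‖) with hR
  have hR1 : 1 ≤ R := one_le_weight hρ l z
  have hCR : 1 ≤ C' * R ^ p' := one_le_mul_of_one_le_of_one_le hC' (one_le_pow₀ hR1)
  have hfz : ‖f l z‖ ≤ C' * R ^ p' := by simpa using hf' 0 (Nat.zero_le _) l z
  have hρR : ρ l ≤ R := le_mul_of_one_le_right (zero_le_one.trans (hρ l)) (by simp)
  have hw : ρ l * (1 + ‖f l z‖) ≤ 2 * C' * R ^ (1 + p') := by
    have h0 := zero_le_one.trans (hρ l)
    calc ρ l * (1 + ‖f l z‖) ≤ R * (C' * R ^ p' + C' * R ^ p') := by gcongr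
      _ = _ := by ring
  have h0 := zero_le_one.trans (one_le_weight hρ l (f l z))
  have key := norm_iteratedFDeriv_comp_le (hg.smooth l) (hf.smooth l)
    (n := k) (by exact_mod_cast le_top) z (C := C * (2 * C' * R ^ (1 + p')) ^ p) (D := C' * R ^ p')
    (fun i hi ↦ (hg' i hi l (f l z)).trans (by gcongr))
    (fun i hi hik ↦ (hf' i hik l z).trans (le_self_pow₀ hCR (by omega)))
  refine key.trans (le_of_eq ?_)
  rw [mul_pow (2 * C') _ p, ← pow_mul, mul_pow C' _ k, ← pow_mul, pow_add R ((1 + p') * p)]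
  ring

theorem prodMk (hρ : ∀ l, 1 ≤ ρ l) {f : Λ → D → E} {g : Λ → D → F} (hf : UniformTemperate ρ f)
    (hg : UniformTemperate ρ g) : UniformTemperate ρ fun l z ↦ (f l z, g l z) := by
  refine ⟨fun l ↦ (hf.smooth l).prodMk (hg.smooth l), fun k ↦ ?_⟩
  obtain ⟨C, p, hC, -, hf'⟩ := hf.bound_uniform hρ k
  obtain ⟨C', p', hC', -, hg'⟩ := hg.bound_uniform hρ k
  refine ⟨C + C', p + p', fun l z ↦ ?_⟩
  have hR1 : 1 ≤ ρ l * (1 + ‖z‖) := one_le_weight hρ l z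
  have hk : ((k : ℕ∞) : WithTop ℕ∞) ≤ (⊤ : ℕ∞) := by exact_mod_cast le_top
  rw [show iteratedFDeriv ℝ k (fun z ↦ (f l z, g l z)) z =
    (iteratedFDeriv ℝ k (f l) z).prod (iteratedFDeriv ℝ k (g l) z) from
      iteratedFDeriv_prodMk ((hf.smooth l).contDiffAt.of_le hk)
        ((hg.smooth l).contDiffAt.of_le hk) le_rfl]
  rw [ContinuousMultilinearMap.opNorm_prod]
  refine max_le ((hf' k le_rfl l z).trans ?_) ((hg' k le_rfl l z).trans ?_)
  · gcongr
    exacts [by linarith, by omega]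
  · gcongr
    exacts [by linarith, by omega]

theorem clm_comp (hρ : ∀ l, 1 ≤ ρ l) (T : E →L[ℝ] F) {f : Λ → D → E}
    (hf : UniformTemperate ρ f) : UniformTemperate ρ fun l z ↦ T (f l z) :=
  (of_hasTemperateGrowth hρ T.hasTemperateGrowth).comp hρ hf

theorem clm (hρ : ∀ l, 1 ≤ ρ l) (T : E →L[ℝ] F) : UniformTemperate ρ fun _ z ↦ T z :=
  of_hasTemperateGrowth hρ T.hasTemperateGrowth

theorem add (hρ : ∀ l, 1 ≤ ρ l) {f g : Λ → D → E} (hf : UniformTemperate ρ f)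
    (hg : UniformTemperate ρ g) : UniformTemperate ρ fun l z ↦ f l z + g l z :=
  (hf.prodMk hρ hg).clm_comp hρ (ContinuousLinearMap.fst ℝ E E + ContinuousLinearMap.snd ℝ E E)

theorem sub (hρ : ∀ l, 1 ≤ ρ l) {f g : Λ → D → E} (hf : UniformTemperate ρ f)
    (hg : UniformTemperate ρ g) : UniformTemperate ρ fun l z ↦ f l z - g l z :=
  (hf.prodMk hρ hg).clm_comp hρ (ContinuousLinearMap.fst ℝ E E - ContinuousLinearMap.snd ℝ E E)

theorem bilin (hρ : ∀ l, 1 ≤ ρ l) (T : E →L[ℝ] F →L[ℝ] G) {f : Λ → D → E} {g : Λ → D → F}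
    (hf : UniformTemperate ρ f) (hg : UniformTemperate ρ g) :
    UniformTemperate ρ fun l z ↦ T (f l z) (g l z) :=
  (of_hasTemperateGrowth hρ (f := fun z : E × F ↦ T z.1 z.2)
    (T.bilinear_hasTemperateGrowth (ContinuousLinearMap.fst ℝ E F).hasTemperateGrowth
      (ContinuousLinearMap.snd ℝ E F).hasTemperateGrowth)).comp hρ (hf.prodMk hρ hg)

theorem mul (hρ : ∀ l, 1 ≤ ρ l) {R : Type} [NormedRing R] [NormedAlgebra ℝ R] {f g : Λ → D → R}
    (hf : UniformTemperate ρ f) (hg : UniformTemperate ρ g) :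
    UniformTemperate ρ fun l z ↦ f l z * g l z :=
  hf.bilin hρ (ContinuousLinearMap.mul ℝ R) hg

theorem smul (hρ : ∀ l, 1 ≤ ρ l) {f : Λ → D → ℝ} {g : Λ → D → E}
    (hf : UniformTemperate ρ f) (hg : UniformTemperate ρ g) :
    UniformTemperate ρ fun l z ↦ f l z • g l z :=
  hf.bilin hρ (ContinuousLinearMap.lsmul ℝ ℝ) hg

theorem sum (hρ : ∀ l, 1 ≤ ρ l) {ι : Type} (s : Finset ι) {f : ι → Λ → D → E}
    (hf : ∀ i, UniformTemperate ρ (f i)) : UniformTemperate ρ fun l z ↦ ∑ i ∈ s, f i l z := by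
  classical
  induction s using Finset.induction_on with
  | empty => simpa using of_hasTemperateGrowth hρ (Function.HasTemperateGrowth.zero (E := D))
  | insert i s hi ih => simpa [Finset.sum_insert hi] using (hf i).add hρ ih

theorem fderiv_apply (hρ : ∀ l, 1 ≤ ρ l) {f : Λ → D → E} (hf : UniformTemperate ρ f) (v : D) :
    UniformTemperate ρ fun l z ↦ fderiv ℝ (f l) z v := by
  have h : UniformTemperate ρ fun l ↦ fderiv ℝ (f l) := by
    refine ⟨fun l ↦ (hf.smooth l).fderiv_right (by simp), fun k ↦ ?_⟩
    simpa only [norm_iteratedFDeriv_fderiv] using hf.bound (k + 1)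
  exact h.clm_comp hρ (ContinuousLinearMap.apply ℝ E v)

theorem setIntegral [ProperSpace D] (hρ : ∀ l, 1 ≤ ρ l) [MeasurableSpace E] [BorelSpace E]
    [SecondCountableTopology E] {μ : Measure E} [IsFiniteMeasureOnCompacts μ] {K : Set E}
    (hK : IsCompact K) {f : Λ → D × E → F} (hf : UniformTemperate ρ f) :
    UniformTemperate ρ fun l x ↦ ∫ y in K, f l (x, y) ∂μ := by
  refine ⟨fun l ↦ contDiff_setIntegral hK (hf.smooth l), fun k ↦ ?_⟩
  obtain ⟨C, p, hC, -, hf'⟩ := hf.bound_uniform hρ k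
  obtain ⟨r, hr, hKr⟩ : ∃ r, 0 ≤ r ∧ ∀ y ∈ K, ‖y‖ ≤ r := by
    obtain ⟨r, hr⟩ := hK.isBounded.exists_norm_le
    exact ⟨max r 0, le_max_right _ _, fun y hy ↦ (hr y hy).trans (le_max_left _ _)⟩
  refine ⟨C * (1 + r) ^ p * μ.real K, p, fun l x ↦ ?_⟩
  have h0 := zero_le_one.trans (hρ l)
  refine (norm_iteratedFDeriv_setIntegral_le hK (hf.smooth l)
    (C := C * (ρ l * ((1 + r) * (1 + ‖x‖))) ^ p) fun y hy ↦
    (norm_iteratedFDeriv_comp_prodMk_le (hf.smooth l) k x y).trans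
      ((hf' k le_rfl l (x, y)).trans ?_)).trans (le_of_eq ?_)
  · gcongr
    rw [Prod.norm_def]
    have := hKr y hy
    have hx := norm_nonneg x
    rcases max_cases ‖x‖ ‖y‖ with ⟨h, -⟩ | ⟨h, -⟩ <;> simp only [h] <;> nlinarith
  · rw [mul_left_comm, mul_pow]; ring

theorem intervalIntegral [ProperSpace D] (hρ : ∀ l, 1 ≤ ρ l) {f : Λ → D × ℝ → F}
    (hf : UniformTemperate ρ f) :
    UniformTemperate ρ fun l x ↦ ∫ s in (0 : ℝ)..1, f l (x, s) := by
  simpa only [_root_.intervalIntegral.integral_of_le (zero_le_one (α := ℝ)),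
    ← integral_Icc_eq_integral_Ioc] using hf.setIntegral hρ (μ := volume) isCompact_Icc

end UniformTemperate

theorem norm_iteratedFDeriv_cexp_I_mul (k : ℕ) (t : ℝ) :
    ‖iteratedFDeriv ℝ k (fun t : ℝ ↦ Complex.exp (Complex.I * t)) t‖ = 1 := by
  have h : ∀ k : ℕ, iteratedDeriv k (fun t : ℝ ↦ Complex.exp (Complex.I * t)) =
      fun t : ℝ ↦ Complex.I ^ k * Complex.exp (Complex.I * t) := by
    intro k
    induction k with
    | zero => simp
    | succ k ih =>
      rw [iteratedDeriv_succ, ih]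
      funext t
      have h1 : HasDerivAt (fun t : ℝ ↦ Complex.exp (Complex.I * t))
          (Complex.exp (Complex.I * t) * (Complex.I * 1)) t :=
        ((Complex.ofRealCLM.hasDerivAt (x := t)).const_mul Complex.I).cexp
      rw [(h1.const_mul (Complex.I ^ k)).deriv]
      ring
  rw [norm_iteratedFDeriv_eq_norm_iteratedDeriv, h]
  simp [mul_comm Complex.I, Complex.norm_exp_ofReal_mul_I]

theorem hasTemperateGrowth_cexp_I_mul :
    Function.HasTemperateGrowth fun t : ℝ ↦ Complex.exp (Complex.I * t) :=
  ⟨(contDiff_const.mul Complex.ofRealCLM.contDiff).cexp,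
    fun k ↦ ⟨0, 1, fun t ↦ by simp [norm_iteratedFDeriv_cexp_I_mul]⟩⟩

section MagneticPhase

variable {d : ℕ}

theorem clm_apply_eq_sum_single (T : E1 d →L[ℝ] ℝ) (u : E1 d) :
    T u = ∑ i, u i * T (Pi.single i 1) := by
  conv_lhs => rw [← Finset.univ_sum_single u, map_sum]
  refine Finset.sum_congr rfl fun i _ ↦ ?_
  rw [← smul_eq_mul, ← map_smul, ← Pi.single_smul, smul_eq_mul, mul_one]

theorem magA_eq_setIntegral {B : Fin d → Fin d → E1 d → ℝ} (hB : ∀ j k, Continuous (B j k))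
    (y x : E1 d) (k : Fin d) :
    magA d B y x k =
      ∫ s in Set.Icc (0 : ℝ) 1, ∑ j, s * (x j - y j) * B j k (y + s • (x - y)) := by
  simp only [magA, intervalIntegral.integral_of_le (zero_le_one (α := ℝ)),
    ← integral_Icc_eq_integral_Ioc]
  refine (integral_finsetSum _ fun j _ ↦ ?_).symm
  exact Continuous.integrableOn_Icc (by have := hB j k; fun_prop)

theorem UniformTemperate.magA {Λ : Type} {ρ : Λ → ℝ} (hρ : ∀ l, 1 ≤ ρ l)
    {B : Λ → Fin d → Fin d → E1 d → ℝ} (hB : ∀ j k, UniformTemperate ρ fun l ↦ B l j k)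
    (k : Fin d) : UniformTemperate ρ fun l x ↦ magA d (B l) 0 x k := by
  unfold _root_.magA
  refine UniformTemperate.sum hρ _ fun j ↦ UniformTemperate.intervalIntegral hρ
    (f := fun l (z : E1 d × ℝ) ↦ z.2 * (z.1 j - (0 : E1 d) j) * B l j k (0 + z.2 • (z.1 - 0))) ?_
  simp only [Pi.zero_apply, sub_zero, zero_add]
  have h1 : UniformTemperate ρ fun _ (z : E1 d × ℝ) ↦ z.1 :=
    clm hρ (ContinuousLinearMap.fst ℝ (E1 d) ℝ)
  have h2 : UniformTemperate ρ fun _ (z : E1 d × ℝ) ↦ z.2 :=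
    clm hρ (ContinuousLinearMap.snd ℝ (E1 d) ℝ)
  exact (h2.mul hρ (h1.clm_comp hρ (ContinuousLinearMap.proj j))).mul hρ
    ((hB j k).comp hρ (h2.smul hρ h1))

theorem UniformTemperate.magPhi {Λ : Type} {ρ : Λ → ℝ} (hρ : ∀ l, 1 ≤ ρ l)
    {B : Λ → Fin d → Fin d → E1 d → ℝ} (hB : ∀ j k, UniformTemperate ρ fun l ↦ B l j k) :
    UniformTemperate ρ fun l (z : E1 d × E1 d) ↦ magPhi d (B l) z.1 z.2 := by
  unfold _root_.magPhi
  refine UniformTemperate.sum hρ _ fun k ↦ UniformTemperate.intervalIntegral hρ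
    (f := fun l (z : (E1 d × E1 d) × ℝ) ↦
      _root_.magA d (B l) 0 (z.1.2 + z.2 • (z.1.1 - z.1.2)) k * (z.1.1 k - z.1.2 k)) ?_
  have h1 : UniformTemperate ρ fun _ (z : (E1 d × E1 d) × ℝ) ↦ z.1.1 :=
    clm hρ ((ContinuousLinearMap.fst ℝ _ _).comp (ContinuousLinearMap.fst ℝ (E1 d × E1 d) ℝ))
  have h2 : UniformTemperate ρ fun _ (z : (E1 d × E1 d) × ℝ) ↦ z.1.2 :=
    clm hρ ((ContinuousLinearMap.snd ℝ _ _).comp (ContinuousLinearMap.fst ℝ (E1 d × E1 d) ℝ))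
  have h3 : UniformTemperate ρ fun _ (z : (E1 d × E1 d) × ℝ) ↦ z.2 :=
    clm hρ (ContinuousLinearMap.snd ℝ (E1 d × E1 d) ℝ)
  exact ((UniformTemperate.magA hρ hB k).comp hρ (h2.add hρ (h3.smul hρ (h1.sub hρ h2)))).mul hρ
    ((h1.clm_comp hρ (ContinuousLinearMap.proj k)).sub hρ
      (h2.clm_comp hρ (ContinuousLinearMap.proj k)))

variable {B : Fin d → Fin d → E1 d → ℝ}

theorem hasFDerivAt_magA (hB : ∀ j k, ContDiff ℝ (⊤ : ℕ∞) (B j k)) (y x : E1 d) (k : Fin d) :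
    DifferentiableAt ℝ (fun x ↦ magA d B y x k) x ∧ ∀ u : E1 d,
      fderiv ℝ (fun x ↦ magA d B y x k) x u = ∫ s in Set.Icc (0 : ℝ) 1,
        ∑ j, (s * u j * B j k (y + s • (x - y)) +
          s * (x j - y j) * (s * fderiv ℝ (B j k) (y + s • (x - y)) u)) := by
  set G : E1 d × ℝ → ℝ := fun z ↦ ∑ j, z.2 * (z.1 j - y j) * B j k (y + z.2 • (z.1 - y)) with hGdef
  have hG : ContDiff ℝ (⊤ : ℕ∞) G := by
    refine ContDiff.sum fun j _ ↦ ?_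
    have := hB j k
    fun_prop
  have h1 := hasFDerivAt_setIntegral_of_contDiff (μ := volume) (isCompact_Icc (a := (0 : ℝ)) (b := 1))
    (hG.of_le (by simp)) x
  have heq : (fun x ↦ magA d B y x k) = fun x ↦ ∫ s in Set.Icc (0 : ℝ) 1, G (x, s) :=
    funext fun x ↦ magA_eq_setIntegral (fun j k ↦ (hB j k).continuous) y x k
  rw [heq]
  refine ⟨h1.differentiableAt, fun u ↦ ?_⟩
  rw [h1.fderiv, ContinuousLinearMap.integral_apply]
  · refine integral_congr_ae (Eventually.of_forall fun s ↦ ?_)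
    have hs : HasFDerivAt (fun x ↦ G (x, s)) ((fderiv ℝ G (x, s)).comp (.inl ℝ (E1 d) ℝ)) x :=
      HasFDerivAt.comp (g := G) x ((hG.differentiable (by simp)) (x, s)).hasFDerivAt
        (hasFDerivAt_prodMk_left (𝕜 := ℝ) x s)
    have hs' : HasFDerivAt (fun x ↦ G (x, s)) (∑ j,
        ((s * (x j - y j)) • ((fderiv ℝ (B j k) (y + s • (x - y))).comp
          (s • ContinuousLinearMap.id ℝ (E1 d))) +
          B j k (y + s • (x - y)) • (s • ContinuousLinearMap.proj (R := ℝ) j))) x := by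
      refine HasFDerivAt.fun_sum fun j _ ↦ ?_
      have ha : HasFDerivAt (fun x : E1 d ↦ s * (x j - y j))
          (s • ContinuousLinearMap.proj (R := ℝ) (φ := fun _ : Fin d ↦ ℝ) j) x :=
        ((hasFDerivAt_apply j x).sub_const (y j)).const_mul s
      have hb : HasFDerivAt (fun x : E1 d ↦ y + s • (x - y)) (s • ContinuousLinearMap.id ℝ (E1 d)) x :=
        (((hasFDerivAt_id x).sub_const y).const_smul s).const_add y
      have hc := (((hB j k).differentiable (by simp)) (y + s • (x - y))).hasFDerivAt.comp x hb
      exact ha.mul hc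
    simp only [hs.unique hs']
    simp only [_root_.sum_apply, _root_.add_apply,
      _root_.smul_apply, ContinuousLinearMap.comp_apply, ContinuousLinearMap.id_apply,
      ContinuousLinearMap.proj_apply, smul_eq_mul, map_smul]
    refine Finset.sum_congr rfl fun j _ ↦ by ring
  · refine (Continuous.integrableOn_Icc ?_)
    have h2 : Continuous fun z ↦ fderiv ℝ G z := hG.continuous_fderiv (by simp)
    exact (h2.comp (by fun_prop : Continuous fun s : ℝ ↦ (x, s))).clm_comp continuous_const

theorem fderiv_single_antisymm (hB : IsRegularMagneticField d B) (j k : Fin d) (x u : E1 d) :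
    fderiv ℝ (B j k) x u = - fderiv ℝ (B k j) x u := by
  have : B j k = fun x ↦ - B k j x := funext fun x ↦ hB.antisymm j k x
  rw [this, fderiv_fun_neg]
  rfl

/-- The exterior derivative of the transversal-gauge potential is the magnetic field. -/
theorem fderiv_magA_sub_fderiv_magA (hB : IsRegularMagneticField d B) (y x : E1 d) (i k : Fin d) :
    fderiv ℝ (fun x ↦ magA d B y x k) x (Pi.single i 1) -
      fderiv ℝ (fun x ↦ magA d B y x i) x (Pi.single k 1) = B i k x := by
  rw [(hasFDerivAt_magA hB.smooth y x k).2, (hasFDerivAt_magA hB.smooth y x i).2]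
  have hint : ∀ (k : Fin d) (u : E1 d), IntegrableOn (fun s : ℝ ↦
      ∑ j, (s * u j * B j k (y + s • (x - y)) +
        s * (x j - y j) * (s * fderiv ℝ (B j k) (y + s • (x - y)) u))) (Set.Icc 0 1) := by
    intro k u
    refine Continuous.integrableOn_Icc (continuous_finsetSum _ fun j _ ↦ ?_)
    have h1 := (hB.smooth j k).continuous
    have h2 : Continuous fun s : ℝ ↦ fderiv ℝ (B j k) (y + s • (x - y)) u :=
      (((hB.smooth j k).continuous_fderiv (by simp)).comp
        (by fun_prop : Continuous fun s : ℝ ↦ y + s • (x - y))).clm_apply continuous_const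
    fun_prop
  rw [← integral_sub (hint k _) (hint i _)]
  have hderiv : ∀ s : ℝ, HasDerivAt (fun s : ℝ ↦ s ^ 2 * B i k (y + s • (x - y)))
      (2 * s * B i k (y + s • (x - y)) + s ^ 2 * fderiv ℝ (B i k) (y + s • (x - y)) (x - y)) s := by
    intro s
    have h1 : HasDerivAt (fun s : ℝ ↦ y + s • (x - y)) (x - y) s := by
      simpa using ((hasDerivAt_id s).smul_const (x - y)).const_add y
    have h2 := (((hB.smooth i k).differentiable (by simp))
      (y + s • (x - y))).hasFDerivAt.comp_hasDerivAt s h1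
    refine ((hasDerivAt_pow 2 s).mul h2).congr_deriv ?_
    simp
  have hcont : Continuous fun s : ℝ ↦
      2 * s * B i k (y + s • (x - y)) + s ^ 2 * fderiv ℝ (B i k) (y + s • (x - y)) (x - y) := by
    have h1 := (hB.smooth i k).continuous
    have h2 : Continuous fun s : ℝ ↦ fderiv ℝ (B i k) (y + s • (x - y)) (x - y) :=
      (((hB.smooth i k).continuous_fderiv (by simp)).comp
        (by fun_prop : Continuous fun s : ℝ ↦ y + s • (x - y))).clm_apply continuous_const
    fun_prop
  have hftc := intervalIntegral.integral_eq_sub_of_hasDerivAt (a := (0 : ℝ)) (b := 1)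
    (fun s _ ↦ hderiv s) (hcont.intervalIntegrable 0 1)
  rw [intervalIntegral.integral_of_le zero_le_one, ← integral_Icc_eq_integral_Ioc] at hftc
  simp only [one_pow, one_mul, one_smul, add_sub_cancel, ne_eq, OfNat.ofNat_ne_zero,
    not_false_eq_true, zero_pow, zero_mul, sub_zero] at hftc
  rw [← hftc]
  refine integral_congr_ae (Eventually.of_forall fun s ↦ ?_)
  simp only
  set p := y + s • (x - y)
  have hexp : fderiv ℝ (B i k) p (x - y) =
      ∑ j, (x j - y j) * fderiv ℝ (B i k) p (Pi.single j 1) := clm_apply_eq_sum_single _ _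
  rw [hexp, ← Finset.sum_sub_distrib]
  have hterm : ∀ j, s * (Pi.single i (1 : ℝ) : E1 d) j * B j k p +
        s * (x j - y j) * (s * fderiv ℝ (B j k) p (Pi.single i 1)) -
      (s * (Pi.single k (1 : ℝ) : E1 d) j * B j i p +
        s * (x j - y j) * (s * fderiv ℝ (B j i) p (Pi.single k 1))) =
      (s * (Pi.single i (1 : ℝ) : E1 d) j * B j k p - s * (Pi.single k (1 : ℝ) : E1 d) j * B j i p) +
        s ^ 2 * ((x j - y j) * fderiv ℝ (B i k) p (Pi.single j 1)) := by
    intro j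
    have h1 := hB.closed i j k p
    have h2 := fderiv_single_antisymm hB k i p (Pi.single j 1)
    have h3 := fderiv_single_antisymm hB i j p (Pi.single k 1)
    have h4 : fderiv ℝ (B i k) p (Pi.single j 1) = fderiv ℝ (B j k) p (Pi.single i 1) -
        fderiv ℝ (B j i) p (Pi.single k 1) := by linarith
    rw [h4]; ring
  rw [Finset.sum_congr rfl fun j _ ↦ hterm j, Finset.sum_add_distrib, ← Finset.mul_sum,
    Finset.sum_sub_distrib]
  simp only [Pi.single_apply, mul_ite, mul_one, mul_zero, ite_mul, zero_mul, Finset.sum_ite_eq',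
    Finset.mem_univ, if_true]
  rw [hB.antisymm k i p]
  ring

theorem magA_translate (a x : E1 d) (k : Fin d) :
    magA d (fun j k x ↦ B j k (a + x)) 0 (x - a) k = magA d B a x k := by
  simp [magA]

/-- Changing the base point of the transversal gauge changes the circulation by a coboundary. -/
theorem exists_magPhi_gauge (hB : IsRegularMagneticField d B) (a : E1 d) :
    ∃ χ : E1 d → ℝ, ∀ x y, magPhi d B x y =
      magPhi d (fun j k x ↦ B j k (a + x)) (x - a) (y - a) + (χ x - χ y) := by
  set A : Fin d → E1 d → ℝ := fun k x ↦ magA d B 0 x k - magA d B a x k with hA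
  have hAd : ∀ k, Differentiable ℝ (A k) := fun k x ↦
    (hasFDerivAt_magA hB.smooth 0 x k).1.sub (hasFDerivAt_magA hB.smooth a x k).1
  set ω : E1 d → E1 d →L[ℝ] ℝ := fun x ↦
    ∑ k, A k x • ContinuousLinearMap.proj (R := ℝ) (φ := fun _ : Fin d ↦ ℝ) k with hω
  have hωd : Differentiable ℝ ω := by
    refine Differentiable.fun_sum fun k _ ↦ (hAd k).smul_const _
  have hfd : ∀ x u v, fderiv ℝ ω x u v = ∑ k, fderiv ℝ (A k) x u * v k := by
    intro x u v
    have h := fderiv_fun_sum (u := Finset.univ) (x := x) fun k _ ↦ ((hAd k).smul_const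
      (ContinuousLinearMap.proj (R := ℝ) (φ := fun _ : Fin d ↦ ℝ) k)) x
    rw [hω, h]
    simp only [_root_.sum_apply]
    refine Finset.sum_congr rfl fun k _ ↦ ?_
    rw [fderiv_smul_const (hAd k x)]
    simp
  have hsymm : ∀ x i k, fderiv ℝ (A k) x (Pi.single i 1) = fderiv ℝ (A i) x (Pi.single k 1) := by
    intro x i k
    have h : ∀ k, fderiv ℝ (A k) x =
        fderiv ℝ (fun x ↦ magA d B 0 x k) x - fderiv ℝ (fun x ↦ magA d B a x k) x := fun k ↦
      fderiv_fun_sub (hasFDerivAt_magA hB.smooth 0 x k).1 (hasFDerivAt_magA hB.smooth a x k).1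
    have h0 := fderiv_magA_sub_fderiv_magA hB 0 x i k
    have h1 := fderiv_magA_sub_fderiv_magA hB a x i k
    simp only [h, _root_.sub_apply]
    linarith
  have hexp : ∀ x (k : Fin d) (u : E1 d), fderiv ℝ (A k) x u =
      ∑ i, u i * fderiv ℝ (A k) x (Pi.single i 1) := fun x k u ↦ clm_apply_eq_sum_single _ _
  obtain ⟨χ, hχ⟩ := convex_univ.exists_forall_hasFDerivAt_of_fderiv_symmetric isOpen_univ
    (ω := ω) hωd.differentiableOn fun x _ u v ↦ by
      rw [hfd, hfd]
      simp only [hexp x _ u, hexp x _ v, Finset.sum_mul]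
      rw [Finset.sum_comm]
      refine Finset.sum_congr rfl fun i _ ↦ Finset.sum_congr rfl fun k _ ↦ ?_
      rw [hsymm x i k]; ring
  refine ⟨χ, fun x y ↦ ?_⟩
  have hcontA : ∀ b k, Continuous fun s : ℝ ↦ magA d B b (y + s • (x - y)) k := fun b k ↦
    (continuous_iff_continuousAt.2 fun x ↦
      (hasFDerivAt_magA hB.smooth b x k).1.continuousAt).comp (by fun_prop)
  have hderiv : ∀ s : ℝ, HasDerivAt (fun s : ℝ ↦ χ (y + s • (x - y)))
      (ω (y + s • (x - y)) (x - y)) s := by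
    intro s
    have h1 : HasDerivAt (fun s : ℝ ↦ y + s • (x - y)) (x - y) s := by
      simpa using ((hasDerivAt_id s).smul_const (x - y)).const_add y
    exact (hχ _ (Set.mem_univ _)).comp_hasDerivAt s h1
  have hftc := intervalIntegral.integral_eq_sub_of_hasDerivAt (a := (0 : ℝ)) (b := 1)
    (fun s _ ↦ hderiv s) (((hωd.continuous.comp (by fun_prop)).clm_apply
      continuous_const).intervalIntegrable 0 1)
  simp only [one_smul, add_sub_cancel, zero_smul, add_zero] at hftc
  have htrans : ∀ (s : ℝ) k, magA d (fun j k x ↦ B j k (a + x)) 0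
      (y - a + s • (x - a - (y - a))) k = magA d B a (y + s • (x - y)) k := by
    intro s k
    rw [sub_sub_sub_cancel_right, sub_add_eq_add_sub]
    exact magA_translate a _ k
  rw [← hftc, magPhi, magPhi]
  simp only [hω, _root_.sum_apply, _root_.smul_apply,
    ContinuousLinearMap.proj_apply, smul_eq_mul, Pi.sub_apply]
  rw [intervalIntegral.integral_finsetSum, ← Finset.sum_add_distrib]
  · refine Finset.sum_congr rfl fun k _ ↦ ?_
    have h0 := hcontA 0 k
    have h1 := hcontA a k
    rw [← intervalIntegral.integral_add]
    · refine intervalIntegral.integral_congr fun s _ ↦ ?_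
      simp only [htrans s k, hA]
      ring
    · simp only [htrans]
      exact Continuous.intervalIntegrable (by fun_prop) _ _
    · exact Continuous.intervalIntegrable (by simp only [hA]; fun_prop) _ _
  · intro k _
    have h0 := hcontA 0 k
    have h1 := hcontA a k
    exact Continuous.intervalIntegrable (by simp only [hA]; fun_prop) _ _

theorem magPhi_zero_right (hB : IsRegularMagneticField d B) (x : E1 d) (a : E1 d) :
    magPhi d (fun j k x ↦ B j k (a + x)) x 0 = 0 := by
  have h : ∀ k s, magA d (fun j k x ↦ B j k (a + x)) 0 (0 + s • (x - 0)) k * (x k - (0 : E1 d) k) =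
      ∑ j, ∫ t in (0 : ℝ)..1, t * (s * x j * x k) * B j k (a + (t * s) • x) := by
    intro k s
    simp only [magA, Finset.sum_mul, ← intervalIntegral.integral_mul_const]
    refine Finset.sum_congr rfl fun j _ ↦ intervalIntegral.integral_congr fun t _ ↦ ?_
    simp [smul_smul]
    ring
  have hanti : ∀ s : ℝ, ∑ k, ∑ j, ∫ t in (0 : ℝ)..1,
      t * (s * x j * x k) * B j k (a + (t * s) • x) = 0 := by
    intro s
    set S := ∑ k, ∑ j, ∫ t in (0 : ℝ)..1, t * (s * x j * x k) * B j k (a + (t * s) • x) with hS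
    have : S = -S := by
      conv_lhs => rw [hS, Finset.sum_comm]
      rw [hS, ← Finset.sum_neg_distrib]
      refine Finset.sum_congr rfl fun k _ ↦ ?_
      rw [← Finset.sum_neg_distrib]
      refine Finset.sum_congr rfl fun j _ ↦ ?_
      rw [← intervalIntegral.integral_neg]
      refine intervalIntegral.integral_congr fun t _ ↦ ?_
      simp only [hB.antisymm k j]
      ring
    linarith
  have hcont : ∀ k, Continuous fun s : ℝ ↦ ∑ j, ∫ t in (0 : ℝ)..1,
      t * (s * x j * x k) * B j k (a + (t * s) • x) := by
    intro k
    refine continuous_finsetSum _ fun j _ ↦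
      intervalIntegral.continuous_parametric_intervalIntegral_of_continuous' ?_ 0 1
    have := (hB.smooth j k).continuous
    simp only [Function.uncurry_def]
    fun_prop
  simp only [magPhi, h]
  rw [← intervalIntegral.integral_finsetSum fun k _ ↦ (hcont k).intervalIntegrable 0 1]
  simp [hanti]

end MagneticPhase

section OscillatoryIntegral

variable {d : ℕ}

theorem norm_cexp_neg_I_mul (t : ℝ) : ‖Complex.exp (-Complex.I * (t : ℂ))‖ = 1 := by
  rw [neg_mul, ← mul_neg, ← Complex.ofReal_neg, mul_comm, Complex.norm_exp_ofReal_mul_I]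

theorem contDiff_fourierChar (η : E1 d) : ContDiff ℝ (⊤ : ℕ∞) fun y : E1 d ↦
    Complex.exp (-Complex.I * ((∑ i, η i * y i : ℝ) : ℂ)) := by
  have h : ContDiff ℝ (⊤ : ℕ∞) fun y : E1 d ↦ ∑ i, η i * y i := by fun_prop
  exact (contDiff_const.mul (Complex.ofRealCLM.contDiff.comp h)).cexp

theorem fderiv_fourierChar (η y : E1 d) (j : Fin d) :
    fderiv ℝ (fun y : E1 d ↦ Complex.exp (-Complex.I * ((∑ i, η i * y i : ℝ) : ℂ))) y
      (Pi.single j 1) =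
    -Complex.I * η j * Complex.exp (-Complex.I * ((∑ i, η i * y i : ℝ) : ℂ)) := by
  have h0 : HasFDerivAt (fun y : E1 d ↦ ∑ i, η i * y i)
      (∑ i, η i • ContinuousLinearMap.proj (R := ℝ) (φ := fun _ : Fin d ↦ ℝ) i) y :=
    HasFDerivAt.fun_sum fun i _ ↦ (hasFDerivAt_apply i y).const_mul (η i)
  have h1 := ((Complex.ofRealCLM.hasFDerivAt.comp y h0).const_mul (-Complex.I)).cexp
  have h2 := h1.fderiv
  simp only [Function.comp_def, Complex.ofRealCLM_apply] at h2
  rw [h2]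
  simp [Pi.single_apply]
  ring

theorem fderiv_eq_zero_of_forall_notMem {X F : Type} [NormedAddCommGroup X] [NormedSpace ℝ X]
    [NormedAddCommGroup F] [NormedSpace ℝ F] {A : X × E1 d → F} {K : Set (E1 d)} (hK : IsClosed K)
    (hA : ∀ x, ∀ y ∉ K, A (x, y) = 0) (x : X) (y : E1 d) (hy : y ∉ K) :
    fderiv ℝ A (x, y) = 0 := by
  have h : A =ᶠ[nhds (x, y)] fun _ ↦ 0 := by
    filter_upwards [(hK.isOpen_compl.preimage continuous_snd).mem_nhds
      (show (x, y) ∈ Prod.snd ⁻¹' Kᶜ from hy)] with z hz using hA z.1 z.2 hz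
  rw [h.fderiv_eq, fderiv_fun_const]
  rfl

variable {X : Type} [NormedAddCommGroup X] [NormedSpace ℝ X]

/-- Differentiation in the `j`-th coordinate of the second variable. -/
def sndDeriv (j : Fin d) (A : X × E1 d → ℂ) (z : X × E1 d) : ℂ :=
  fderiv ℝ A z (0, Pi.single j 1)

theorem contDiff_sndDeriv (j : Fin d) {A : X × E1 d → ℂ} (hA : ContDiff ℝ (⊤ : ℕ∞) A) :
    ContDiff ℝ (⊤ : ℕ∞) (sndDeriv j A) :=
  (hA.fderiv_right (by simp)).clm_apply contDiff_const

theorem mul_setIntegral_fourierChar (j : Fin d) {A : X × E1 d → ℂ}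
    (hA : ContDiff ℝ (⊤ : ℕ∞) A) {K : Set (E1 d)} (hK : IsCompact K)
    (hAK : ∀ x, ∀ y ∉ K, A (x, y) = 0) (η : E1 d) (x : X) :
    Complex.I * η j * ∫ y in K, Complex.exp (-Complex.I * ((∑ i, η i * y i : ℝ) : ℂ)) * A (x, y) =
      ∫ y in K, Complex.exp (-Complex.I * ((∑ i, η i * y i : ℝ) : ℂ)) * sndDeriv j A (x, y) := by
  set e : E1 d → ℂ := fun y ↦ Complex.exp (-Complex.I * ((∑ i, η i * y i : ℝ) : ℂ)) with he
  have hec : Continuous e := (contDiff_fourierChar η).continuous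
  have hAx : ContDiff ℝ (⊤ : ℕ∞) fun y ↦ A (x, y) := hA.comp (by fun_prop)
  have hsd : ∀ y, fderiv ℝ (fun y ↦ A (x, y)) y (Pi.single j 1) = sndDeriv j A (x, y) := by
    intro y
    have h := HasFDerivAt.comp (g := A) y ((hA.differentiable (by simp)) (x, y)).hasFDerivAt
      (hasFDerivAt_prodMk_right (𝕜 := ℝ) x y)
    have h' := h.fderiv
    simp only [Function.comp_def] at h'
    rw [h']
    simp [sndDeriv]
  have hsdK : ∀ y ∉ K, sndDeriv j A (x, y) = 0 := fun y hy ↦ by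
    rw [sndDeriv, fderiv_eq_zero_of_forall_notMem hK.isClosed hAK x y hy]; rfl
  have hint : ∀ {f : E1 d → ℂ}, Continuous f → (∀ y ∉ K, f y = 0) → Integrable f :=
    fun hf h ↦ hf.integrable_of_hasCompactSupport (HasCompactSupport.intro hK h)
  have hed : ∀ y, fderiv ℝ e y (Pi.single j 1) = -Complex.I * η j * e y :=
    fun y ↦ fderiv_fourierChar η y j
  have hsdc : Continuous fun y ↦ sndDeriv j A (x, y) :=
    (contDiff_sndDeriv j hA).continuous.comp (by fun_prop)
  have hAc := hAx.continuous
  have key := integral_mul_fderiv_eq_neg_fderiv_mul_of_integrable (μ := volume) (f := e)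
    (g := fun y ↦ A (x, y)) (v := Pi.single j 1)
    (by simp only [hed]; exact hint (by fun_prop) fun y hy ↦ by simp [hAK x y hy])
    (by simp only [hsd]; exact hint (by fun_prop) fun y hy ↦ by simp [hsdK y hy])
    (hint (by fun_prop) fun y hy ↦ by simp [hAK x y hy])
    (fun y _ ↦ (contDiff_fourierChar η).differentiable (by simp) y)
    (fun y _ ↦ hAx.differentiable (by simp) y)
  simp only [hsd, hed] at key
  rw [setIntegral_eq_integral_of_forall_compl_eq_zero fun y hy ↦ by simp [hAK x y hy],
    setIntegral_eq_integral_of_forall_compl_eq_zero fun y hy ↦ by simp [hsdK y hy], key,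
    ← integral_const_mul, ← integral_neg]
  refine integral_congr_ae (Eventually.of_forall fun y ↦ ?_)
  simp only
  ring

theorem iterate_sndDeriv (j : Fin d) {A : X × E1 d → ℂ}
    (hA : ContDiff ℝ (⊤ : ℕ∞) A) {K : Set (E1 d)} (hK : IsCompact K)
    (hAK : ∀ x, ∀ y ∉ K, A (x, y) = 0) (n : ℕ) :
    ContDiff ℝ (⊤ : ℕ∞) ((sndDeriv j)^[n] A) ∧
      ∀ (η : E1 d) (x : X), (Complex.I * η j) ^ n *
        ∫ y in K, Complex.exp (-Complex.I * ((∑ i, η i * y i : ℝ) : ℂ)) * A (x, y) =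
      ∫ y in K, Complex.exp (-Complex.I * ((∑ i, η i * y i : ℝ) : ℂ)) *
        (sndDeriv j)^[n] A (x, y) := by
  induction n generalizing A with
  | zero => exact ⟨hA, fun η x ↦ by simp⟩
  | succ n ih =>
    obtain ⟨h1, h2⟩ := ih (contDiff_sndDeriv j hA) fun x y hy ↦ by
      rw [sndDeriv, fderiv_eq_zero_of_forall_notMem hK.isClosed hAK x y hy]; rfl
    refine ⟨h1, fun η x ↦ ?_⟩
    rw [Function.iterate_succ_apply, ← h2, pow_succ, mul_assoc,
      mul_setIntegral_fourierChar j hA hK hAK]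

variable [ProperSpace X]

theorem norm_iteratedFDeriv_fourierChar_setIntegral_le {A : X × E1 d → ℂ}
    (hA : ContDiff ℝ (⊤ : ℕ∞) A) {K : Set (E1 d)} (hK : IsCompact K) (η : E1 d) {k : ℕ} {x : X}
    {C : ℝ} (hC : ∀ y ∈ K, ‖iteratedFDeriv ℝ k A (x, y)‖ ≤ C) :
    ‖iteratedFDeriv ℝ k (fun x ↦
        ∫ y in K, Complex.exp (-Complex.I * ((∑ i, η i * y i : ℝ) : ℂ)) * A (x, y)) x‖ ≤
      C * volume.real K := by
  have he := (contDiff_fourierChar η).comp (contDiff_snd (E := X) (F := E1 d))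
  refine norm_iteratedFDeriv_setIntegral_le (μ := volume) hK (he.mul hA) fun y hy ↦ ?_
  have hAy : ContDiff ℝ (⊤ : ℕ∞) fun x ↦ A (x, y) := hA.comp (by fun_prop)
  have h := iteratedFDeriv_const_smul_apply (𝕜 := ℝ) (i := k) (x := x)
    (a := Complex.exp (-Complex.I * ((∑ i, η i * y i : ℝ) : ℂ)))
    (hAy.contDiffAt.of_le (by exact_mod_cast le_top))
  simp only [Pi.smul_def, smul_eq_mul] at h
  simp only [Function.comp_def]
  rw [h, norm_smul, norm_cexp_neg_I_mul, one_mul]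
  exact (norm_iteratedFDeriv_comp_prodMk_le hA k x y).trans (hC y hy)

theorem contDiff_fourierChar_setIntegral {A : X × E1 d → ℂ}
    (hA : ContDiff ℝ (⊤ : ℕ∞) A) {K : Set (E1 d)} (hK : IsCompact K) (η : E1 d) :
    ContDiff ℝ (⊤ : ℕ∞) fun x ↦
      ∫ y in K, Complex.exp (-Complex.I * ((∑ i, η i * y i : ℝ) : ℂ)) * A (x, y) :=
  contDiff_setIntegral (μ := volume) hK
    (((contDiff_fourierChar η).comp (contDiff_snd (E := X) (F := E1 d))).mul hA)

theorem pow_mul_norm_iteratedFDeriv_fourierChar_setIntegral_le {A : X × E1 d → ℂ}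
    (hA : ContDiff ℝ (⊤ : ℕ∞) A) {K : Set (E1 d)} (hK : IsCompact K)
    (hAK : ∀ x, ∀ y ∉ K, A (x, y) = 0) (η : E1 d) (j : Fin d) {k n : ℕ} {x : X} {C : ℝ}
    (hC : ∀ y ∈ K, ‖iteratedFDeriv ℝ k ((sndDeriv j)^[n] A) (x, y)‖ ≤ C) :
    |η j| ^ n * ‖iteratedFDeriv ℝ k (fun x ↦
        ∫ y in K, Complex.exp (-Complex.I * ((∑ i, η i * y i : ℝ) : ℂ)) * A (x, y)) x‖ ≤
      C * volume.real K := by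
  obtain ⟨h1, h2⟩ := iterate_sndDeriv j hA hK hAK n
  refine le_trans (le_of_eq ?_) (norm_iteratedFDeriv_fourierChar_setIntegral_le h1 hK η hC)
  simp only [← h2]
  have h := iteratedFDeriv_const_smul_apply (𝕜 := ℝ) (i := k) (x := x)
    (a := (Complex.I * (η j : ℂ)) ^ n)
    ((contDiff_fourierChar_setIntegral hA hK η).contDiffAt.of_le (by exact_mod_cast le_top))
  simp only [Pi.smul_def, smul_eq_mul] at h
  rw [h, norm_smul]
  simp

end OscillatoryIntegral

section GaborAmplitude

variable {d : ℕ}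

theorem UniformTemperate.iterate_sndDeriv {Λ X : Type} [NormedAddCommGroup X] [NormedSpace ℝ X]
    {ρ : Λ → ℝ} (hρ : ∀ l, 1 ≤ ρ l) {A : Λ → X × E1 d → ℂ} (hA : UniformTemperate ρ A)
    (j : Fin d) (n : ℕ) : UniformTemperate ρ fun l ↦ (sndDeriv j)^[n] (A l) := by
  induction n generalizing A with
  | zero => exact hA
  | succ n ih => exact ih (hA.fderiv_apply hρ (0, Pi.single j 1))

theorem norm_pow_le_one_add_sum (η : E1 d) (n : ℕ) : ‖η‖ ^ n ≤ 1 + ∑ j, |η j| ^ n := by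
  have hs : ∀ j, |η j| ^ n ≤ ∑ j, |η j| ^ n := fun j ↦
    Finset.single_le_sum (f := fun j ↦ |η j| ^ n) (fun _ _ ↦ by positivity) (Finset.mem_univ j)
  rcases isEmpty_or_nonempty (Fin d) with h | h
  · simp [Subsingleton.elim η 0]
    rcases n with _ | n <;> simp
  · obtain ⟨j, hj⟩ := Finite.exists_max fun j ↦ |η j|
    have h1 : ‖η‖ ≤ |η j| := (pi_norm_le_iff_of_nonneg (abs_nonneg _)).2 hj
    have h2 : ‖η‖ ^ n ≤ |η j| ^ n := by gcongr
    linarith [hs j]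

theorem UniformTemperate.norm_iteratedFDeriv_fourierChar_setIntegral_le {Λ : Type} {ρ : Λ → ℝ}
    (hρ : ∀ l, 1 ≤ ρ l) {A : Λ → E2 d × E1 d → ℂ} (hA : UniformTemperate ρ A)
    (hAy : ∀ l x, ∀ y ∉ Metric.closedBall (0 : E1 d) 2, A l (x, y) = 0)
    (hAw : ∀ l (x : E2 d) y, 1 < ‖x.1‖ → A l (x, y) = 0) (k n : ℕ) :
    ∃ (C : ℝ) (p : ℕ), ∀ l (w η : E1 d), (1 + ‖(w, η)‖) ^ n * ‖iteratedFDeriv ℝ k (fun x ↦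
      ∫ y in Metric.closedBall (0 : E1 d) 2,
        Complex.exp (-Complex.I * ((∑ i, η i * y i : ℝ) : ℂ)) * A l (x, y)) (w, 0)‖ ≤
      C * ρ l ^ p := by
  set K := Metric.closedBall (0 : E1 d) 2
  have hK : IsCompact K := isCompact_closedBall 0 2
  set V := volume.real K
  have hV : 0 ≤ V := measureReal_nonneg
  obtain ⟨C₀, p₀, hC₀, -, h₀⟩ := hA.bound_uniform hρ k
  choose C p hC hp h using fun j ↦ (hA.iterate_sndDeriv hρ j n).bound_uniform hρ k
  have hz : ∀ l (w y : E1 d), ‖w‖ ≤ 1 → y ∈ K →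
      ρ l * (1 + ‖(((w, 0) : E2 d), y)‖) ≤ 3 * ρ l := by
    intro l w y hw hy
    have hy' : ‖y‖ ≤ 2 := by simpa [K] using hy
    have h1 : ‖(((w, 0) : E2 d), y)‖ ≤ 2 := by
      simp only [Prod.norm_def, norm_zero]
      exact max_le (max_le (by linarith) (by norm_num)) hy'
    have := hρ l
    nlinarith
  set P := p₀ + ∑ j, p j
  have hpP : ∀ j, p j ≤ P := fun j ↦
    (Finset.single_le_sum (f := p) (fun _ _ ↦ Nat.zero_le _) (Finset.mem_univ j)).trans
      le_add_self
  have hpow : ∀ (D : ℝ) (q : ℕ) l, 1 ≤ D → q ≤ P → D * (3 * ρ l) ^ q ≤ D * 3 ^ P * ρ l ^ P := by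
    intro D q l hD hq
    rw [mul_assoc, ← mul_pow]
    have h3 : 1 ≤ 3 * ρ l := by linarith [hρ l]
    gcongr
  refine ⟨3 ^ n * (2 * (C₀ * 3 ^ P * V) + ∑ j, C j * 3 ^ P * V), P, fun l w η ↦ ?_⟩
  have hρ0 : 0 ≤ ρ l := zero_le_one.trans (hρ l)
  set T := ‖iteratedFDeriv ℝ k (fun x ↦ ∫ y in K,
        Complex.exp (-Complex.I * ((∑ i, η i * y i : ℝ) : ℂ)) * A l (x, y)) (w, 0)‖ with hT
  have hT0 : 0 ≤ T := norm_nonneg _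
  rcases lt_or_ge 1 ‖w‖ with hw | hw
  · have hT' : T = 0 := by
      have hev : (fun x : E2 d ↦ ∫ y in K,
          Complex.exp (-Complex.I * ((∑ i, η i * y i : ℝ) : ℂ)) * A l (x, y)) =ᶠ[nhds (w, 0)]
          fun _ ↦ 0 := by
        have hopen : IsOpen {x : E2 d | 1 < ‖x.1‖} :=
          isOpen_lt continuous_const (by fun_prop)
        filter_upwards [hopen.mem_nhds (show ((w, 0) : E2 d) ∈ {x : E2 d | 1 < ‖x.1‖} from hw)]
          with x hx
        simp [hAw l x _ hx]
      rw [hT, (hev.iteratedFDeriv (𝕜 := ℝ) k).eq_of_nhds]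
      have h0 : (fun _ : E2 d ↦ (0 : ℂ)) = 0 := rfl
      rw [h0, iteratedFDeriv_zero]
      simp
    rw [hT', mul_zero]
    have : 0 ≤ ∑ j, C j * 3 ^ P * V := Finset.sum_nonneg fun j _ ↦ by
      have := hC j
      positivity
    positivity
  · have hT₀ : T ≤ C₀ * 3 ^ P * V * ρ l ^ P := by
      refine (_root_.norm_iteratedFDeriv_fourierChar_setIntegral_le (hA.smooth l) hK η
        (C := C₀ * 3 ^ P * ρ l ^ P) fun y hy ↦ ?_).trans (le_of_eq (by ring))
      refine (h₀ k le_rfl l _).trans (le_trans ?_ (hpow C₀ p₀ l hC₀ (Nat.le_add_right _ _)))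
      have h1 := one_le_weight hρ l (((w, 0) : E2 d), y)
      have := hz l w y hw hy
      gcongr
    have hTj : ∀ j, |η j| ^ n * T ≤ C j * 3 ^ P * V * ρ l ^ P := by
      intro j
      refine (pow_mul_norm_iteratedFDeriv_fourierChar_setIntegral_le (hA.smooth l) hK (hAy l) η j
        (C := C j * 3 ^ P * ρ l ^ P) fun y hy ↦ ?_).trans (le_of_eq (by ring))
      refine (h j k le_rfl l _).trans (le_trans ?_ (hpow (C j) (p j) l (hC j) (hpP j)))
      have h1 := one_le_weight hρ l (((w, 0) : E2 d), y)
      have h2 := hC j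
      have := hz l w y hw hy
      gcongr
    have hη : (1 + ‖(w, η)‖) ^ n ≤ 3 ^ n * (2 + ∑ j, |η j| ^ n) := by
      have h1 : 1 + ‖(w, η)‖ ≤ 3 * max 1 ‖η‖ := by
        have h2 : ‖(w, η)‖ ≤ max 1 ‖η‖ := by
          rw [Prod.norm_def]; exact max_le_max hw le_rfl
        linarith [le_max_left 1 ‖η‖]
      calc (1 + ‖(w, η)‖) ^ n ≤ (3 * max 1 ‖η‖) ^ n := by gcongr
        _ = 3 ^ n * (max 1 ‖η‖) ^ n := mul_pow _ _ _
        _ ≤ 3 ^ n * (1 + ‖η‖ ^ n) := by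
          gcongr
          rcases max_choice 1 ‖η‖ with h2 | h2 <;> rw [h2]
          · rw [one_pow]; linarith [pow_nonneg (norm_nonneg η) n]
          · linarith
        _ ≤ _ := by
          refine mul_le_mul_of_nonneg_left ?_ (by positivity)
          linarith [norm_pow_le_one_add_sum η n]
    calc (1 + ‖(w, η)‖) ^ n * T ≤ 3 ^ n * (2 + ∑ j, |η j| ^ n) * T := by gcongr
      _ = 3 ^ n * (2 * T + ∑ j, |η j| ^ n * T) := by rw [← Finset.sum_mul]; ring
      _ ≤ 3 ^ n * (2 * (C₀ * 3 ^ P * V * ρ l ^ P) + ∑ j, C j * 3 ^ P * V * ρ l ^ P) := by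
        refine mul_le_mul_of_nonneg_left (add_le_add (by linarith) ?_) (by positivity)
        exact (Finset.sum_le_sum fun j _ ↦ hTj j)
      _ = _ := by rw [← Finset.sum_mul]; ring

/-- An integer vector regarded as a real one. -/
def intVec (n : Fin d → ℤ) : E1 d := fun i ↦ (n i : ℝ)

/-- The off-diagonal weight `1 + ‖α - γ‖ + ‖α' - γ'‖`. -/
def idxWeight (l : Idx d × Idx d) : ℝ :=
  1 + ‖intVec l.1.1 - intVec l.2.1‖ + ‖intVec l.1.2 - intVec l.2.2‖

/-- The midpoint of two indices. -/
def idxMid (l : Idx d × Idx d) : E2 d :=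
  ((2 : ℝ)⁻¹ • (intVec l.1.1 + intVec l.2.1), (2 : ℝ)⁻¹ • (intVec l.1.2 + intVec l.2.2))

theorem one_le_idxWeight (l : Idx d × Idx d) : 1 ≤ idxWeight l := by
  unfold idxWeight
  linarith [norm_nonneg (intVec l.1.1 - intVec l.2.1), norm_nonneg (intVec l.1.2 - intVec l.2.2)]

/-- The part of the phase of the dequantized frame symbol, centred at its midpoint, which has
derivatives of controlled growth. -/
def gaborPhase (B : Fin d → Fin d → E1 d → ℝ) (l : Idx d × Idx d) (z : E2 d × E1 d) : ℝ :=
  ∑ i, (intVec l.1.2 - intVec l.2.2) i * z.1.1 i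
    - ∑ i, z.1.2 i * ((intVec l.1.1 - intVec l.2.1) i + z.2 i)
    - magPhi d (fun j k x ↦ B j k (intVec l.1.1 + x)) (z.1.1 + (2 : ℝ)⁻¹ • z.2)
        (z.1.1 - (2 : ℝ)⁻¹ • z.2 - (intVec l.1.1 - intVec l.2.1))
    - magPhi d (fun j k x ↦ B j k (intVec l.1.1 + x))
        (z.1.1 - (2 : ℝ)⁻¹ • z.2 - (intVec l.1.1 - intVec l.2.1))
        (0 - (intVec l.1.1 - intVec l.2.1))

/-- The amplitude of the dequantized frame symbol, centred at its midpoint. -/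
def gaborAmplitude (B : Fin d → Fin d → E1 d → ℝ) (g : E1 d → ℝ) (l : Idx d × Idx d)
    (z : E2 d × E1 d) : ℂ :=
  Complex.exp (Complex.I * (gaborPhase B l z : ℂ)) *
    (((g (z.1.1 + (2 : ℝ)⁻¹ • z.2) : ℝ) : ℂ) * ((g (z.1.1 - (2 : ℝ)⁻¹ • z.2) : ℝ) : ℂ))

variable {B : Fin d → Fin d → E1 d → ℝ} {g : E1 d → ℝ}

theorem uniformTemperate_gaborPhase (hB : IsRegularMagneticField d B) :
    UniformTemperate idxWeight (gaborPhase B) := by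
  have hρ := one_le_idxWeight (d := d)
  have hw : UniformTemperate (idxWeight (d := d)) fun _ (z : E2 d × E1 d) ↦ z.1.1 :=
    .clm hρ ((ContinuousLinearMap.fst ℝ (E1 d) (E1 d)).comp
      (ContinuousLinearMap.fst ℝ (E2 d) (E1 d)))
  have hθ : UniformTemperate (idxWeight (d := d)) fun _ (z : E2 d × E1 d) ↦ z.1.2 :=
    .clm hρ ((ContinuousLinearMap.snd ℝ (E1 d) (E1 d)).comp
      (ContinuousLinearMap.fst ℝ (E2 d) (E1 d)))
  have hy : UniformTemperate (idxWeight (d := d)) fun _ (z : E2 d × E1 d) ↦ z.2 :=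
    .clm hρ (ContinuousLinearMap.snd ℝ (E2 d) (E1 d))
  have hy2 : UniformTemperate (idxWeight (d := d)) fun _ (z : E2 d × E1 d) ↦ (2 : ℝ)⁻¹ • z.2 :=
    .clm hρ ((2 : ℝ)⁻¹ • ContinuousLinearMap.snd ℝ (E2 d) (E1 d))
  have hδ : UniformTemperate (idxWeight (d := d)) fun l (_ : E2 d × E1 d) ↦
      intVec l.1.1 - intVec l.2.1 := .const_of_le hρ fun l ↦ by
    unfold idxWeight; linarith [norm_nonneg (intVec l.1.2 - intVec l.2.2)]
  have hκ : UniformTemperate (idxWeight (d := d)) fun l (_ : E2 d × E1 d) ↦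
      intVec l.1.2 - intVec l.2.2 := .const_of_le hρ fun l ↦ by
    unfold idxWeight; linarith [norm_nonneg (intVec l.1.1 - intVec l.2.1)]
  have h0 : UniformTemperate (idxWeight (d := d)) fun _ (_ : E2 d × E1 d) ↦ (0 : E1 d) :=
    .const_of_le hρ fun l ↦ by simpa using zero_le_one.trans (hρ l)
  have hBt : ∀ j k, UniformTemperate (idxWeight (d := d)) fun l x ↦ B j k (intVec l.1.1 + x) :=
    fun j k ↦ .of_bounded (fun l ↦ (hB.smooth j k).comp (by fun_prop)) fun n ↦
      (hB.derivBounded j k n).imp fun C hC l x ↦ by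
        rw [iteratedFDeriv_comp_add_left]; exact hC _
  have hφ := UniformTemperate.magPhi hρ hBt
  have hq := (hw.sub hρ hy2).sub hρ hδ
  have hproj : ∀ {f : Idx d × Idx d → E2 d × E1 d → E1 d}, UniformTemperate idxWeight f → ∀ i,
      UniformTemperate idxWeight fun l z ↦ f l z i := fun hf i ↦
    hf.clm_comp hρ (ContinuousLinearMap.proj (R := ℝ) (φ := fun _ : Fin d ↦ ℝ) i)
  have h1 := UniformTemperate.sum hρ Finset.univ fun i ↦ (hproj hκ i).mul hρ (hproj hw i)
  have h2 := UniformTemperate.sum hρ Finset.univ fun i ↦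
    (hproj hθ i).mul hρ ((hproj hδ i).add hρ (hproj hy i))
  have h3 := hφ.comp hρ ((hw.add hρ hy2).prodMk hρ hq)
  have h4 := hφ.comp hρ (hq.prodMk hρ (h0.sub hρ hδ))
  exact ((h1.sub hρ h2).sub hρ h3).sub hρ h4

theorem IsWindow.exists_norm_iteratedFDeriv_le (hg : IsWindow d g) (k : ℕ) :
    ∃ C, ∀ x, ‖iteratedFDeriv ℝ k g x‖ ≤ C :=
  (hg.compactSupport.iteratedFDeriv (𝕜 := ℝ) k).exists_bound_of_continuous
    (hg.smooth.continuous_iteratedFDeriv (by exact_mod_cast le_top))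

theorem uniformTemperate_gaborAmplitude (hB : IsRegularMagneticField d B) (hg : IsWindow d g) :
    UniformTemperate idxWeight (gaborAmplitude B g) := by
  have hρ := one_le_idxWeight (d := d)
  have hgt : UniformTemperate (idxWeight (d := d)) fun _ x ↦ ((g x : ℝ) : ℂ) :=
    UniformTemperate.clm_comp hρ Complex.ofRealCLM (.of_bounded (fun _ ↦ hg.smooth) fun k ↦
      (hg.exists_norm_iteratedFDeriv_le k).imp fun C hC _ ↦ hC)
  have he := UniformTemperate.of_hasTemperateGrowth (ρ := idxWeight (d := d)) hρ
    hasTemperateGrowth_cexp_I_mul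
  have hadd := UniformTemperate.clm (ρ := idxWeight (d := d)) hρ
    ((ContinuousLinearMap.fst ℝ (E1 d) (E1 d)).comp (ContinuousLinearMap.fst ℝ (E2 d) (E1 d)) +
      (2 : ℝ)⁻¹ • ContinuousLinearMap.snd ℝ (E2 d) (E1 d))
  have hsub := UniformTemperate.clm (ρ := idxWeight (d := d)) hρ
    ((ContinuousLinearMap.fst ℝ (E1 d) (E1 d)).comp (ContinuousLinearMap.fst ℝ (E2 d) (E1 d)) -
      (2 : ℝ)⁻¹ • ContinuousLinearMap.snd ℝ (E2 d) (E1 d))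
  exact (he.comp hρ (uniformTemperate_gaborPhase hB)).mul hρ
    ((hgt.comp hρ hadd).mul hρ (hgt.comp hρ hsub))

theorem IsWindow.eq_zero_of_one_lt (hg : IsWindow d g) {x : E1 d} (hx : 1 < ‖x‖) : g x = 0 := by
  by_contra h
  exact absurd ((pi_norm_le_iff_of_nonneg zero_le_one).2 fun i ↦ (hg.support_subset x h i).le)
    (not_le.2 hx)

theorem gaborAmplitude_eq_zero_of_fst (hg : IsWindow d g) (l : Idx d × Idx d) (x : E2 d)
    (y : E1 d) (hx : 1 < ‖x.1‖) : gaborAmplitude B g l (x, y) = 0 := by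
  have h : x.1 = (2 : ℝ)⁻¹ • ((x.1 + (2 : ℝ)⁻¹ • y) + (x.1 - (2 : ℝ)⁻¹ • y)) := by module
  have h1 := norm_add_le (x.1 + (2 : ℝ)⁻¹ • y) (x.1 - (2 : ℝ)⁻¹ • y)
  rw [h, norm_smul, Real.norm_of_nonneg (by norm_num)] at hx
  rcases lt_or_ge 1 ‖x.1 + (2 : ℝ)⁻¹ • y‖ with h2 | h2
  · simp [gaborAmplitude, hg.eq_zero_of_one_lt h2]
  · simp [gaborAmplitude, hg.eq_zero_of_one_lt (x := x.1 - (2 : ℝ)⁻¹ • y) (by linarith)]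

theorem gaborAmplitude_eq_zero_of_snd (hg : IsWindow d g) (l : Idx d × Idx d) (x : E2 d)
    (y : E1 d) (hy : y ∉ Metric.closedBall (0 : E1 d) 2) : gaborAmplitude B g l (x, y) = 0 := by
  have hy' : 2 < ‖y‖ := by simpa using hy
  have h : y = (x.1 + (2 : ℝ)⁻¹ • y) - (x.1 - (2 : ℝ)⁻¹ • y) := by module
  have h1 := norm_sub_le (x.1 + (2 : ℝ)⁻¹ • y) (x.1 - (2 : ℝ)⁻¹ • y)
  rw [← h] at h1
  rcases lt_or_ge 1 ‖x.1 + (2 : ℝ)⁻¹ • y‖ with h2 | h2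
  · simp [gaborAmplitude, hg.eq_zero_of_one_lt h2]
  · simp [gaborAmplitude, hg.eq_zero_of_one_lt (x := x.1 - (2 : ℝ)⁻¹ • y) (by linarith)]

end GaborAmplitude

section DequantizedSymbol

variable {d : ℕ} {B : Fin d → Fin d → E1 d → ℝ} {g : E1 d → ℝ}

theorem gabor_eq (a : Idx d) (x : E1 d) : gabor d B g a x =
    (((2 * Real.pi) ^ (-(d : ℝ) / 2) : ℝ) : ℂ) * ((g (x - intVec a.1) : ℝ) : ℂ) *
      Complex.exp (Complex.I * ((magPhi d B x (intVec a.1) +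
        ∑ i, intVec a.2 i * (x i - intVec a.1 i) : ℝ) : ℂ)) := by
  rw [Complex.ofReal_add, mul_add, Complex.exp_add]
  simp only [gabor]
  unfold intVec
  ring

theorem star_gabor_eq (a : Idx d) (x : E1 d) : (starRingEnd ℂ) (gabor d B g a x) =
    (((2 * Real.pi) ^ (-(d : ℝ) / 2) : ℝ) : ℂ) * ((g (x - intVec a.1) : ℝ) : ℂ) *
      Complex.exp (Complex.I * ((-(magPhi d B x (intVec a.1) +
        ∑ i, intVec a.2 i * (x i - intVec a.1 i)) : ℝ) : ℂ)) := by
  rw [gabor_eq, map_mul, map_mul, Complex.conj_ofReal, Complex.conj_ofReal, ← Complex.exp_conj,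
    map_mul, Complex.conj_I, Complex.conj_ofReal, Complex.ofReal_neg, neg_mul, mul_neg]

theorem exists_deqSymbol_eq (hB : IsRegularMagneticField d B) (hg : IsWindow d g)
    (l : Idx d × Idx d) (η : E1 d) : ∃ c : ℂ, ‖c‖ ≤ 1 ∧ ∀ x : E2 d,
      deqSymbol d B g l (x + (idxMid l + (0, η))) =
        c * ∫ y in Metric.closedBall (0 : E1 d) 2,
          Complex.exp (-Complex.I * ((∑ i, η i * y i : ℝ) : ℂ)) * gaborAmplitude B g l (x, y) := by
  obtain ⟨χ, hχ⟩ := exists_magPhi_gauge hB (intVec l.1.1)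
  set a := intVec l.1.1 with ha
  set a' := intVec l.1.2 with ha'
  set c := intVec l.2.1 with hc
  set c' := intVec l.2.2 with hc'
  set r : ℝ := (2 * Real.pi) ^ (-(d : ℝ) / 2) with hr
  set b : ℝ := χ c - χ a - ∑ i, ((2 : ℝ)⁻¹ * (a' i + c' i) + η i) * (a i - c i) with hb
  have hr0 : 0 ≤ r := by positivity
  have hr1 : r ≤ 1 := Real.rpow_le_one_of_one_le_of_nonpos
    (by linarith [Real.pi_gt_three]) (by
      have : (0 : ℝ) ≤ d := Nat.cast_nonneg d
      linarith)
  refine ⟨(r : ℂ) * r * Complex.exp (Complex.I * (b : ℂ)), ?_, fun x ↦ ?_⟩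
  · rw [norm_mul, norm_mul, mul_comm Complex.I, Complex.norm_exp_ofReal_mul_I, mul_one,
      Complex.norm_real, Real.norm_of_nonneg hr0]
    exact mul_le_one₀ hr1 hr0 hr1
  obtain ⟨w, θ⟩ := x
  rw [setIntegral_eq_integral_of_forall_compl_eq_zero fun y hy ↦ by
      rw [gaborAmplitude_eq_zero_of_snd hg l _ y hy, mul_zero], ← integral_const_mul, deqSymbol,
    ← integral_add_left_eq_self _ (a - c)]
  refine integral_congr_ae (Eventually.of_forall fun y ↦ ?_)
  have e1 : ((w, θ) + (idxMid l + (0, η))).1 + (2 : ℝ)⁻¹ • ((a - c) + y) =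
      a + (w + (2 : ℝ)⁻¹ • y) := by
    simp only [idxMid, Prod.fst_add, ← ha, ← hc, add_zero]
    module
  have e2 : ((w, θ) + (idxMid l + (0, η))).1 - (2 : ℝ)⁻¹ • ((a - c) + y) =
      c + (w - (2 : ℝ)⁻¹ • y) := by
    simp only [idxMid, Prod.fst_add, ← ha, ← hc, add_zero]
    module
  have e3 : ((w, θ) + (idxMid l + (0, η))).2 = θ + ((2 : ℝ)⁻¹ • (a' + c') + η) := rfl
  simp only [e1, e2, e3, star_gabor_eq]
  simp only [gabor_eq, gaborAmplitude, ← ha, ← hc, ← ha', ← hc', ← hr,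
    add_sub_cancel_left]
  set p := w + (2 : ℝ)⁻¹ • y with hp
  set q := w - (2 : ℝ)⁻¹ • y with hq
  have hphase : -(∑ i, (θ + ((2 : ℝ)⁻¹ • (a' + c') + η)) i * ((a - c) + y) i)
      - magPhi d B (a + p) (c + q)
      + (magPhi d B (a + p) a + ∑ i, a' i * ((a + p) i - a i))
      + -(magPhi d B (c + q) c + ∑ i, c' i * ((c + q) i - c i)) =
      b + -(∑ i, η i * y i) + gaborPhase B l ((w, θ), y) := by
    have h1 := hχ (a + p) (c + q)
    have h2 := hχ (a + p) a
    have h3 := hχ (c + q) c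
    have h4 := magPhi_zero_right hB p a
    have s1 : c + q - a = q - (a - c) := by abel
    have s2 : c - a = 0 - (a - c) := by abel
    rw [add_sub_cancel_left, sub_self, h4] at h2
    rw [add_sub_cancel_left, s1] at h1
    rw [s1, s2] at h3
    have hsum : -(∑ i, (θ + ((2 : ℝ)⁻¹ • (a' + c') + η)) i * ((a - c) + y) i) +
        ∑ i, a' i * ((a + p) i - a i) - ∑ i, c' i * ((c + q) i - c i) =
        -(∑ i, ((2 : ℝ)⁻¹ * (a' i + c' i) + η i) * (a i - c i)) - ∑ i, η i * y i +
        ∑ i, (a' - c') i * w i - ∑ i, θ i * ((a - c) i + y i) := by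
      simp only [← Finset.sum_neg_distrib, ← Finset.sum_sub_distrib, ← Finset.sum_add_distrib]
      refine Finset.sum_congr rfl fun i _ ↦ ?_
      simp only [hp, hq, Pi.add_apply, Pi.sub_apply, Pi.smul_apply, smul_eq_mul]
      ring
    simp only [gaborPhase, ← ha, ← hc, ← ha', ← hc', ← hp, ← hq]
    rw [h1, h2, h3, hb]
    linarith
  have hexp : ∀ t : ℝ, Complex.exp (-Complex.I * (t : ℂ)) =
      Complex.exp (Complex.I * ((-t : ℝ) : ℂ)) := fun t ↦ by
    rw [Complex.ofReal_neg, mul_neg, neg_mul]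
  have hmul : ∀ s t : ℝ, Complex.exp (Complex.I * ((s + t : ℝ) : ℂ)) =
      Complex.exp (Complex.I * (s : ℂ)) * Complex.exp (Complex.I * (t : ℂ)) := fun s t ↦ by
    rw [Complex.ofReal_add, mul_add, Complex.exp_add]
  have hE := congrArg (fun t : ℝ ↦ Complex.exp (Complex.I * (t : ℂ))) hphase
  simp only [hmul, sub_eq_add_neg] at hE
  simp only [hexp, hmul]
  simp only [sub_eq_add_neg]
  linear_combination ((r : ℂ) * r * (g p : ℂ) * (g q : ℂ)) * hE

theorem contDiff_deqSymbol (hB : IsRegularMagneticField d B) (hg : IsWindow d g)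
    (l : Idx d × Idx d) : ContDiff ℝ (⊤ : ℕ∞) (deqSymbol d B g l) := by
  obtain ⟨c, -, hc⟩ := exists_deqSymbol_eq hB hg l 0
  have h : deqSymbol d B g l = fun x ↦ c * ∫ y in Metric.closedBall (0 : E1 d) 2,
      Complex.exp (-Complex.I * ((∑ i, (0 : E1 d) i * y i : ℝ) : ℂ)) *
        gaborAmplitude B g l (x - (idxMid l + (0, 0)), y) := funext fun x ↦ by
    rw [← hc, sub_add_cancel]
  rw [h]
  exact contDiff_const.mul ((contDiff_fourierChar_setIntegral
    ((uniformTemperate_gaborAmplitude hB hg).smooth l) (isCompact_closedBall 0 2) 0).comp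
    (contDiff_id.sub contDiff_const))

/-- The dequantized frame symbols are Schwartz functions centred at the midpoint of their indices,
with seminorms growing polynomially in the distance of the indices. -/
theorem exists_norm_iteratedFDeriv_deqSymbol_le (hB : IsRegularMagneticField d B)
    (hg : IsWindow d g) (k n : ℕ) : ∃ (C : ℝ) (p : ℕ), ∀ (l : Idx d × Idx d) (X : E2 d),
      (1 + ‖X - idxMid l‖) ^ n * ‖iteratedFDeriv ℝ k (deqSymbol d B g l) X‖ ≤
        C * idxWeight l ^ p := by
  obtain ⟨C, p, h⟩ :=
    (uniformTemperate_gaborAmplitude hB hg).norm_iteratedFDeriv_fourierChar_setIntegral_le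
    one_le_idxWeight (fun l x y hy ↦ gaborAmplitude_eq_zero_of_snd hg l x y hy)
    (fun l x y hx ↦ gaborAmplitude_eq_zero_of_fst hg l x y hx) k n
  refine ⟨C, p, fun l X ↦ le_trans ?_ (h l (X - idxMid l).1 (X - idxMid l).2)⟩
  set η := (X - idxMid l).2
  obtain ⟨c, hc1, hc⟩ := exists_deqSymbol_eq hB hg l η
  have hX : X = ((X - idxMid l).1, 0) + (idxMid l + (0, η)) := by
    ext i <;> simp [η]
  have hD := iteratedFDeriv_const_smul_apply (𝕜 := ℝ) (i := k) (x := ((X - idxMid l).1, (0 : E1 d)))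
    (a := c) ((contDiff_fourierChar_setIntegral ((uniformTemperate_gaborAmplitude hB hg).smooth l)
      (isCompact_closedBall 0 2) η).contDiffAt.of_le (by exact_mod_cast le_top))
  simp only [Pi.smul_def, smul_eq_mul, ← hc] at hD
  rw [iteratedFDeriv_comp_add_right, ← hX] at hD
  rw [hD, norm_smul]
  gcongr
  exact mul_le_of_le_one_left (norm_nonneg _) hc1

end DequantizedSymbol

section LocalSeries

variable {α E F : Type*} [NormedAddCommGroup E] [NormedSpace ℝ E] [NormedAddCommGroup F]
  [NormedSpace ℝ F] [CompleteSpace F] {f : α → E → F} {v : ℕ → ℝ → α → ℝ}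

theorem hasFDerivAt_tsum_iteratedFDeriv_of_ball (hf : ∀ i, ContDiff ℝ (⊤ : ℕ∞) (f i))
    (hv : ∀ k R, Summable (v k R))
    (h : ∀ k R i x, ‖x‖ < R → ‖iteratedFDeriv ℝ k (f i) x‖ ≤ v k R i) (k : ℕ) (x : E) :
    HasFDerivAt (fun y ↦ ∑' i, iteratedFDeriv ℝ k (f i) y)
      (∑' i, fderiv ℝ (iteratedFDeriv ℝ k (f i)) x) x := by
  have hx : x ∈ Metric.ball (0 : E) (‖x‖ + 1) := by simp
  refine hasFDerivAt_tsum_of_isPreconnected (hv (k + 1) (‖x‖ + 1)) Metric.isOpen_ball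
    (convex_ball (0 : E) (‖x‖ + 1)).isPreconnected (fun i y _ ↦
      ((hf i).differentiable_iteratedFDeriv
        (by exact_mod_cast WithTop.coe_lt_top k) y).hasFDerivAt)
    (fun i y hy ↦ ?_) hx (.of_norm_bounded (hv k (‖x‖ + 1)) fun i ↦ h k _ i x (by simp)) hx
  have := h (k + 1) (‖x‖ + 1) i y (by simpa using hy)
  simpa only [iteratedFDeriv_succ_eq_comp_left, LinearIsometryEquiv.norm_map,
    Function.comp_apply] using this

/-- Termwise differentiation of a series whose derivatives are all dominated by summable families
on every ball. -/
theorem iteratedFDeriv_tsum_of_ball (hf : ∀ i, ContDiff ℝ (⊤ : ℕ∞) (f i))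
    (hv : ∀ k R, Summable (v k R))
    (h : ∀ k R i x, ‖x‖ < R → ‖iteratedFDeriv ℝ k (f i) x‖ ≤ v k R i) (k : ℕ) :
    (iteratedFDeriv ℝ k fun y ↦ ∑' i, f i y) = fun x ↦ ∑' i, iteratedFDeriv ℝ k (f i) x := by
  induction k with
  | zero =>
    ext1 x
    simp_rw [iteratedFDeriv_zero_eq_comp]
    exact (continuousMultilinearCurryFin0 ℝ E F).symm.toContinuousLinearEquiv.map_tsum
  | succ k ih =>
    ext1 x
    simp_rw [iteratedFDeriv_succ_eq_comp_left, Function.comp_apply, ih,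
      (hasFDerivAt_tsum_iteratedFDeriv_of_ball hf hv h k x).fderiv]
    exact (continuousMultilinearCurryLeftEquiv ℝ
      (fun _ : Fin (k + 1) => E) F).symm.toContinuousLinearEquiv.map_tsum

theorem contDiff_tsum_of_ball (hf : ∀ i, ContDiff ℝ (⊤ : ℕ∞) (f i))
    (hv : ∀ k R, Summable (v k R))
    (h : ∀ k R i x, ‖x‖ < R → ‖iteratedFDeriv ℝ k (f i) x‖ ≤ v k R i) :
    ContDiff ℝ (⊤ : ℕ∞) fun y ↦ ∑' i, f i y := by
  refine contDiff_of_differentiable_iteratedFDeriv fun k _ x ↦ ?_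
  rw [iteratedFDeriv_tsum_of_ball hf hv h]
  exact (hasFDerivAt_tsum_iteratedFDeriv_of_ball hf hv h k x).differentiableAt

theorem tendstoUniformlyOn_iteratedFDeriv_sum (hf : ∀ i, ContDiff ℝ (⊤ : ℕ∞) (f i))
    (hv : ∀ k R, Summable (v k R))
    (h : ∀ k R i x, ‖x‖ < R → ‖iteratedFDeriv ℝ k (f i) x‖ ≤ v k R i) (k : ℕ) {K : Set E}
    (hK : IsCompact K) :
    TendstoUniformlyOn (fun (s : Finset α) x ↦ iteratedFDeriv ℝ k (fun y ↦ ∑ i ∈ s, f i y) x)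
      (iteratedFDeriv ℝ k fun y ↦ ∑' i, f i y) atTop K := by
  obtain ⟨R, hR⟩ := hK.isBounded.exists_norm_le
  rw [iteratedFDeriv_tsum_of_ball hf hv h]
  refine (tendstoUniformlyOn_tsum (hv k (R + 1)) fun i x hx ↦
    h k (R + 1) i x ((hR x hx).trans_lt (lt_add_one R))).congr (Eventually.of_forall fun s x _ ↦ ?_)
  dsimp only
  exact (iteratedFDeriv_fun_sum_apply fun i _ ↦
    ((hf i).of_le (by exact_mod_cast le_top)).contDiffAt).symm

end LocalSeries

section Tensor

theorem norm_iteratedFDeriv_comp_clm_le {E E' F : Type*} [NormedAddCommGroup E] [NormedSpace ℝ E]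
    [NormedAddCommGroup E'] [NormedSpace ℝ E'] [NormedAddCommGroup F] [NormedSpace ℝ F]
    (L : E →L[ℝ] E') (hL : ‖L‖ ≤ 1) {f : E' → F} (hf : ContDiff ℝ (⊤ : ℕ∞) f) (k : ℕ) (x : E) :
    ‖iteratedFDeriv ℝ k (fun y ↦ f (L y)) x‖ ≤ ‖iteratedFDeriv ℝ k f (L x)‖ := by
  have h := L.iteratedFDeriv_comp_right hf x (i := k) (by exact_mod_cast le_top)
  rw [show (fun y ↦ f (L y)) = f ∘ L from rfl, h]
  refine (ContinuousMultilinearMap.norm_compContinuousLinearMap_le _ _).trans ?_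
  exact mul_le_of_le_one_right (norm_nonneg _)
    (Finset.prod_le_one (fun _ _ ↦ norm_nonneg _) fun _ _ ↦ hL)

theorem norm_iteratedFDeriv_tensor_le {E E' : Type*} [NormedAddCommGroup E] [NormedSpace ℝ E]
    [NormedAddCommGroup E'] [NormedSpace ℝ E'] {f : E → ℂ} {g : E' → ℂ}
    (hf : ContDiff ℝ (⊤ : ℕ∞) f) (hg : ContDiff ℝ (⊤ : ℕ∞) g) (k : ℕ) (X : E × E') :
    ‖iteratedFDeriv ℝ k (fun Y : E × E' ↦ f Y.1 * g Y.2) X‖ ≤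
      ∑ i ∈ Finset.range (k + 1),
        (k.choose i : ℝ) * ‖iteratedFDeriv ℝ i f X.1‖ * ‖iteratedFDeriv ℝ (k - i) g X.2‖ := by
  refine (norm_iteratedFDeriv_mul_le (hf.comp contDiff_fst) (hg.comp contDiff_snd) X
    (n := k) (by exact_mod_cast le_top)).trans ?_
  gcongr
  · exact norm_iteratedFDeriv_comp_clm_le (.fst ℝ E E') (ContinuousLinearMap.norm_fst_le ..) hf _ X
  · exact norm_iteratedFDeriv_comp_clm_le (.snd ℝ E E') (ContinuousLinearMap.norm_snd_le ..) hg _ X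

end Tensor

section FrameTensor

variable {d : ℕ} {B : Fin d → Fin d → E1 d → ℝ} {g : E1 d → ℝ}

/-- The embedding of pairs of indices as lattice points of `ℝ^{4d}`. -/
def idxPoint (p : Idx2 d) : E4 d :=
  ((intVec p.1.1, intVec p.1.2), (intVec p.2.1, intVec p.2.2))

theorem norm_intVec (n : Fin d → ℤ) : ‖intVec n‖ = ‖n‖ := by
  refine le_antisymm ((pi_norm_le_iff_of_nonneg (norm_nonneg n)).2 fun i ↦ ?_)
    ((pi_norm_le_iff_of_nonneg (norm_nonneg (intVec n))).2 fun i ↦ ?_)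
  · simpa [intVec, Int.norm_eq_abs] using norm_le_pi_norm n i
  · simpa [intVec, Int.norm_eq_abs] using norm_le_pi_norm (intVec n) i

theorem intVec_sub (m n : Fin d → ℤ) : intVec (m - n) = intVec m - intVec n := by
  ext i; simp [intVec]

theorem norm_idxPoint (p : Idx2 d) : ‖idxPoint p‖ = ‖p‖ := by
  simp only [idxPoint, Prod.norm_def, norm_intVec]

theorem idxPoint_sub (p q : Idx2 d) : idxPoint (p - q) = idxPoint p - idxPoint q := by
  simp only [idxPoint, Prod.fst_sub, Prod.snd_sub, intVec_sub, Prod.mk_sub_mk]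

theorem one_le_jbDiffIdx2 (p q : Idx2 d) : 1 ≤ jbDiffIdx2 d p q := by
  rw [jbDiffIdx2, Real.one_le_sqrt, add_assoc, add_assoc, add_assoc]
  exact le_add_of_nonneg_right (by positivity)

theorem norm_sub_le_jbDiffIdx2 (p q : Idx2 d) : ‖p - q‖ ≤ jbDiffIdx2 d p q := by
  have h0 := (zero_le_one.trans (one_le_jbDiffIdx2 p q))
  have h : ∀ f : Fin d → ℤ, 0 ≤ ∑ i, (f i : ℝ) ^ 2 := fun f ↦ by positivity
  have key : ∀ f : Fin d → ℤ, ∑ i, (f i : ℝ) ^ 2 ≤ 1 + (∑ i, ((p.1.1 i - q.1.1 i : ℤ) : ℝ) ^ 2) +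
      (∑ i, ((p.1.2 i - q.1.2 i : ℤ) : ℝ) ^ 2) + (∑ i, ((p.2.1 i - q.2.1 i : ℤ) : ℝ) ^ 2) +
      ∑ i, ((p.2.2 i - q.2.2 i : ℤ) : ℝ) ^ 2 → ‖f‖ ≤ jbDiffIdx2 d p q := fun f hf ↦ by
    refine (pi_norm_le_iff_of_nonneg h0).2 fun i ↦ ?_
    rw [Int.norm_eq_abs]
    exact Real.abs_le_sqrt ((Finset.single_le_sum (f := fun i ↦ (f i : ℝ) ^ 2)
      (fun _ _ ↦ by positivity) (Finset.mem_univ i)).trans hf)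
  have h1 := h (p.1.1 - q.1.1)
  have h2 := h (p.1.2 - q.1.2)
  have h3 := h (p.2.1 - q.2.1)
  have h4 := h (p.2.2 - q.2.2)
  simp only [Pi.sub_apply] at h1 h2 h3 h4
  simp only [Prod.norm_def, Prod.fst_sub, Prod.snd_sub]
  refine max_le (max_le ?_ ?_) (max_le ?_ ?_) <;> refine key _ ?_ <;>
    simp only [Pi.sub_apply] <;> linarith

theorem idxWeight_le (a b : Idx d) {c : ℝ} (hc : 1 ≤ c) (h : ‖a - b‖ ≤ c) :
    idxWeight (a, b) ≤ 3 * c := by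
  have h1 := (norm_fst_le (a - b)).trans h
  have h2 := (norm_snd_le (a - b)).trans h
  simp only [idxWeight, ← intVec_sub, norm_intVec]
  simp only [Prod.fst_sub, Prod.snd_sub] at h1 h2
  linarith

theorem midIdx2_eq_idxMid (p q : Idx2 d) :
    midIdx2 d p q = (idxMid (p.1, q.1), idxMid (q.2, p.2)) := by
  ext i <;> simp [midIdx2, idxMid, intVec] <;> ring

theorem midIdx2_sub_idxPoint_left (p q : Idx2 d) :
    midIdx2 d p q - idxPoint p = (2 : ℝ)⁻¹ • idxPoint (q - p) := by
  ext i <;> simp [midIdx2, idxPoint, intVec] <;> ring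

theorem midIdx2_sub_idxPoint_right (p q : Idx2 d) :
    midIdx2 d p q - idxPoint q = (2 : ℝ)⁻¹ • idxPoint (p - q) := by
  ext i <;> simp [midIdx2, idxPoint, intVec] <;> ring

theorem norm_midIdx2_sub_idxPoint_left_le (p q : Idx2 d) :
    ‖midIdx2 d p q - idxPoint p‖ ≤ jbDiffIdx2 d p q := by
  rw [midIdx2_sub_idxPoint_left, norm_smul, norm_idxPoint, norm_sub_rev]
  have := norm_sub_le_jbDiffIdx2 p q
  have := one_le_jbDiffIdx2 p q
  norm_num
  linarith

theorem norm_midIdx2_sub_idxPoint_right_le (p q : Idx2 d) :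
    ‖midIdx2 d p q - idxPoint q‖ ≤ jbDiffIdx2 d p q := by
  rw [midIdx2_sub_idxPoint_right, norm_smul, norm_idxPoint]
  have := norm_sub_le_jbDiffIdx2 p q
  have := one_le_jbDiffIdx2 p q
  norm_num
  linarith

/-- The symbol `g_{α̃,γ̃} ⊗ g_{δ̃,β̃}` on `ℝ^{4d}`. -/
def frameTensor (B : Fin d → Fin d → E1 d → ℝ) (g : E1 d → ℝ) (q : Idx2 d × Idx2 d) (X : E4 d) :
    ℂ :=
  deqSymbol d B g (q.1.1, q.2.1) X.1 * deqSymbol d B g (q.2.2, q.1.2) X.2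

theorem contDiff_frameTensor (hB : IsRegularMagneticField d B) (hg : IsWindow d g)
    (q : Idx2 d × Idx2 d) : ContDiff ℝ (⊤ : ℕ∞) (frameTensor B g q) :=
  ((contDiff_deqSymbol hB hg _).comp contDiff_fst).mul
    ((contDiff_deqSymbol hB hg _).comp contDiff_snd)

theorem exists_norm_iteratedFDeriv_frameTensor_le (hB : IsRegularMagneticField d B)
    (hg : IsWindow d g) (k n : ℕ) : ∃ (C : ℝ) (m : ℕ), 0 ≤ C ∧ ∀ (q : Idx2 d × Idx2 d) (X : E4 d),
      (1 + ‖X - midIdx2 d q.1 q.2‖) ^ n * ‖iteratedFDeriv ℝ k (frameTensor B g q) X‖ ≤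
        C * jbDiffIdx2 d q.1 q.2 ^ m := by
  choose C p h using fun i ↦ exists_norm_iteratedFDeriv_deqSymbol_le hB hg i n
  set S := ∑ i ∈ Finset.range (k + 1), |C i|
  set P := ∑ i ∈ Finset.range (k + 1), p i
  have hS : 0 ≤ S := Finset.sum_nonneg fun _ _ ↦ abs_nonneg _
  have hi : ∀ i ∈ Finset.range (k + 1), ∀ l : Idx d × Idx d, ∀ X, ∀ c : ℝ, 1 ≤ c →
      idxWeight l ≤ 3 * c → (1 + ‖X - idxMid l‖) ^ n *
        ‖iteratedFDeriv ℝ i (deqSymbol d B g l) X‖ ≤ S * (3 * c) ^ P := by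
    intro i hi l X c hc hl
    refine (h i l X).trans ?_
    have h1 : C i ≤ S := (le_abs_self _).trans
      (Finset.single_le_sum (f := fun i ↦ |C i|) (fun _ _ ↦ abs_nonneg _) hi)
    have h2 : p i ≤ P := Finset.single_le_sum (f := p) (fun _ _ ↦ Nat.zero_le _) hi
    have h3 := one_le_idxWeight l
    have h4 : idxWeight l ^ p i ≤ (3 * c) ^ P :=
      (pow_le_pow_right₀ h3 h2).trans (by gcongr)
    calc C i * idxWeight l ^ p i ≤ S * idxWeight l ^ p i := by gcongr
      _ ≤ _ := by gcongr
  refine ⟨2 ^ k * S ^ 2 * 3 ^ (2 * P), 2 * P, by positivity, fun q X ↦ ?_⟩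
  set c := jbDiffIdx2 d q.1 q.2
  have hc : 1 ≤ c := one_le_jbDiffIdx2 _ _
  have hn := norm_sub_le_jbDiffIdx2 q.1 q.2
  set l₁ := (q.1.1, q.2.1)
  set l₂ := (q.2.2, q.1.2)
  have hl₁ : idxWeight l₁ ≤ 3 * c := idxWeight_le _ _ hc ((norm_fst_le (q.1 - q.2)).trans hn)
  have hl₂ : idxWeight l₂ ≤ 3 * c := idxWeight_le _ _ hc
    (by rw [norm_sub_rev]; exact (norm_snd_le (q.1 - q.2)).trans hn)
  set a := 1 + ‖X.1 - idxMid l₁‖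
  set b := 1 + ‖X.2 - idxMid l₂‖
  have ha : 1 ≤ a := by simp [a]
  have hb : 1 ≤ b := by simp [b]
  have hab : 1 + ‖X - midIdx2 d q.1 q.2‖ ≤ a * b := by
    rw [midIdx2_eq_idxMid, Prod.norm_def, ← le_sub_iff_add_le']
    have h1 : ‖X.1 - idxMid l₁‖ = a - 1 := by simp [a]
    have h2 : ‖X.2 - idxMid l₂‖ = b - 1 := by simp [b]
    exact max_le (h1.le.trans (by nlinarith)) (h2.le.trans (by nlinarith))
  calc _ ≤ (a * b) ^ n * ∑ i ∈ Finset.range (k + 1), (k.choose i : ℝ) *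
          ‖iteratedFDeriv ℝ i (deqSymbol d B g l₁) X.1‖ *
          ‖iteratedFDeriv ℝ (k - i) (deqSymbol d B g l₂) X.2‖ := by
        gcongr
        exact norm_iteratedFDeriv_tensor_le (contDiff_deqSymbol hB hg l₁)
          (contDiff_deqSymbol hB hg l₂) k X
    _ = ∑ i ∈ Finset.range (k + 1), (k.choose i : ℝ) *
          ((a ^ n * ‖iteratedFDeriv ℝ i (deqSymbol d B g l₁) X.1‖) *
          (b ^ n * ‖iteratedFDeriv ℝ (k - i) (deqSymbol d B g l₂) X.2‖)) := by
        rw [Finset.mul_sum, mul_pow]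
        exact Finset.sum_congr rfl fun i _ ↦ by ring
    _ ≤ ∑ i ∈ Finset.range (k + 1), (k.choose i : ℝ) *
          ((S * (3 * c) ^ P) * (S * (3 * c) ^ P)) := by
        refine Finset.sum_le_sum fun i hik ↦ mul_le_mul_of_nonneg_left
          (mul_le_mul (hi i hik l₁ X.1 c hc hl₁)
            (hi (k - i) (Finset.mem_range.2 (by omega)) l₂ X.2 c hc hl₂)
            (by positivity) (by positivity)) (by positivity)
    _ = 2 ^ k * S ^ 2 * 3 ^ (2 * P) * c ^ (2 * P) := by
        rw [← Finset.sum_mul, ← Nat.cast_sum, Nat.sum_range_choose]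
        push_cast
        ring

end FrameTensor

section LatticeSums

variable {d : ℕ}

theorem exists_summable_one_add_norm_int (d : ℕ) :
    ∃ t : ℕ, Summable fun n : Fin d → ℤ ↦ ((1 + ‖n‖) ^ t)⁻¹ := by
  set L := Submodule.span ℤ (Set.range (Pi.basisFun ℝ (Fin d)))
  have hmem : ∀ n : Fin d → ℤ, intVec n ∈ L := fun n ↦
    (Module.Basis.mem_span_iff_repr_mem ℤ (Pi.basisFun ℝ (Fin d)) _).2
      fun i ↦ ⟨n i, by simp [intVec]⟩
  have hinj : Function.Injective fun n : Fin d → ℤ ↦ (⟨intVec n, hmem n⟩ : L) := fun m n h ↦ by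
    ext i
    have := congrFun (Subtype.ext_iff.1 h) i
    simpa [intVec] using this
  refine ⟨Module.finrank ℤ L + 1, .of_norm_bounded_eventually
    ((ZLattice.summable_norm_pow_inv L _ (Nat.lt_succ_self _)).comp_injective hinj) ?_⟩
  filter_upwards [(Set.finite_singleton (0 : Fin d → ℤ)).compl_mem_cofinite] with n hn
  have hn' : 0 < ‖n‖ := norm_pos_iff.2 hn
  simp only [Function.comp_apply, Submodule.coe_norm, norm_intVec]
  rw [Real.norm_of_nonneg (by positivity), inv_pow]
  gcongr
  linarith

theorem Summable.one_add_norm_prod {α β : Type*} [SeminormedAddCommGroup α]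
    [SeminormedAddCommGroup β] {s t : ℕ} (hs : Summable fun a : α ↦ ((1 + ‖a‖) ^ s)⁻¹)
    (ht : Summable fun b : β ↦ ((1 + ‖b‖) ^ t)⁻¹) :
    Summable fun c : α × β ↦ ((1 + ‖c‖) ^ (s + t))⁻¹ := by
  refine .of_nonneg_of_le (fun c ↦ by positivity) (fun c ↦ ?_)
    (hs.mul_of_nonneg ht (fun _ ↦ by positivity) fun _ ↦ by positivity)
  rw [← mul_inv, pow_add]
  gcongr
  · exact norm_fst_le c
  · exact norm_snd_le c

theorem exists_summable_one_add_norm_idx2 (d : ℕ) :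
    ∃ t : ℕ, Summable fun p : Idx2 d ↦ ((1 + ‖p‖) ^ t)⁻¹ := by
  obtain ⟨t, ht⟩ := exists_summable_one_add_norm_int d
  exact ⟨_, (ht.one_add_norm_prod ht).one_add_norm_prod (ht.one_add_norm_prod ht)⟩

theorem exists_norm_sub_idxPoint_le_one (X : E4 d) : ∃ p : Idx2 d, ‖X - idxPoint p‖ ≤ 1 := by
  have h : ∀ x : E1 d, ‖x - intVec fun i ↦ ⌊x i⌋‖ ≤ 1 := fun x ↦
    (pi_norm_le_iff_of_nonneg zero_le_one).2 fun i ↦ by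
      simp only [Pi.sub_apply, intVec, Real.norm_eq_abs, Int.self_sub_floor, Int.abs_fract]
      exact (Int.fract_lt_one _).le
  exact ⟨((fun i ↦ ⌊X.1.1 i⌋, fun i ↦ ⌊X.1.2 i⌋), (fun i ↦ ⌊X.2.1 i⌋, fun i ↦ ⌊X.2.2 i⌋)),
    max_le (max_le (h _) (h _)) (max_le (h _) (h _))⟩

theorem one_add_norm_le_mul {E : Type*} [SeminormedAddCommGroup E] (x y : E) :
    1 + ‖x‖ ≤ (1 + ‖y‖) * (1 + ‖x - y‖) := by
  have h1 := norm_le_norm_add_norm_sub' x y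
  nlinarith [norm_nonneg y, norm_nonneg (x - y)]

theorem inv_one_add_norm_sub_idxPoint_le (X : E4 d) (p p₀ : Idx2 d) (t : ℕ) :
    ((1 + ‖X - idxPoint p‖) ^ t)⁻¹ ≤
      (1 + ‖X - idxPoint p₀‖) ^ t * ((1 + ‖p₀ - p‖) ^ t)⁻¹ := by
  have h := one_add_norm_le_mul (idxPoint p₀ - idxPoint p) (idxPoint p₀ - X)
  rw [sub_sub_sub_cancel_left, ← idxPoint_sub, norm_idxPoint, norm_sub_rev _ X] at h
  have h' := pow_le_pow_left₀ (by positivity) h t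
  rw [mul_pow] at h'
  rw [← div_eq_mul_inv, inv_eq_one_div, div_le_div_iff₀ (by positivity) (by positivity), one_mul]
  exact h'

end LatticeSums

section FrameSeries

variable {d : ℕ} {B : Fin d → Fin d → E1 d → ℝ} {g : E1 d → ℝ} {M : E4 d → ℝ}

theorem jbE4_le (v : E4 d) : jbE4 d v ≤ (1 + 4 * d) * (1 + ‖v‖) := by
  have hs : ∀ x : E1 d, ‖x‖ ≤ ‖v‖ → ∑ i, x i ^ 2 ≤ d * ‖v‖ ^ 2 := fun x hx ↦ by
    refine (Finset.sum_le_card_nsmul _ _ (‖v‖ ^ 2) fun i _ ↦ ?_).trans (by simp)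
    rw [← sq_abs]
    gcongr
    exact (norm_le_pi_norm x i).trans hx
  have h1 := norm_fst_le v
  have h2 := norm_snd_le v
  have e1 := hs v.1.1 ((norm_fst_le _).trans h1)
  have e2 := hs v.1.2 ((norm_snd_le _).trans h1)
  have e3 := hs v.2.1 ((norm_fst_le _).trans h2)
  have e4 := hs v.2.2 ((norm_snd_le _).trans h2)
  have hv := norm_nonneg v
  have hd : (0 : ℝ) ≤ d := Nat.cast_nonneg d
  refine Real.sqrt_le_iff.2 ⟨by positivity, ?_⟩
  calc _ ≤ 1 + 4 * d * ‖v‖ ^ 2 := by linarith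
    _ ≤ (1 + 4 * d) ^ 2 * (1 + ‖v‖ ^ 2) := by nlinarith [mul_nonneg hd (sq_nonneg ‖v‖)]
    _ ≤ (1 + 4 * d) ^ 2 * (1 + ‖v‖) ^ 2 := by gcongr; nlinarith
    _ = _ := by ring

theorem IsTemperedWeightE4.exists_le_mul (hM : IsTemperedWeightE4 d M) :
    ∃ (C : ℝ) (A : ℕ), 0 ≤ C ∧ ∀ X Y, M X ≤ C * M Y * (1 + ‖X - Y‖) ^ A := by
  obtain ⟨hpos, C, hC, a, ha, h⟩ := hM
  refine ⟨C * (1 + 4 * d) ^ ⌈a⌉₊, ⌈a⌉₊, by positivity, fun X Y ↦ ?_⟩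
  have hY := hpos Y
  have h1 := h Y (X - Y)
  rw [add_sub_cancel] at h1
  refine h1.trans ?_
  have hj : 0 ≤ jbE4 d (X - Y) := Real.sqrt_nonneg _
  have h2 : jbE4 d (X - Y) ^ a ≤ ((1 + 4 * d) * (1 + ‖X - Y‖)) ^ ⌈a⌉₊ := by
    refine (Real.rpow_le_rpow hj (jbE4_le _) ha.le).trans ?_
    rw [← Real.rpow_natCast]
    refine Real.rpow_le_rpow_of_exponent_le ?_ (Nat.le_ceil a)
    have := norm_nonneg (X - Y)
    have hd : (0 : ℝ) ≤ d := Nat.cast_nonneg d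
    nlinarith [mul_nonneg hd this]
  calc _ ≤ C * M Y * ((1 + 4 * d) * (1 + ‖X - Y‖)) ^ ⌈a⌉₊ := by gcongr
    _ = _ := by rw [mul_pow]; ring

theorem one_le_mul_inv_one_add_norm_sub_idxPoint (X : E4 d) (q : Idx2 d × Idx2 d) (t : ℕ) :
    1 ≤ (1 + ‖X - midIdx2 d q.1 q.2‖) ^ (2 * t) * (2 * jbDiffIdx2 d q.1 q.2) ^ (2 * t) *
      (((1 + ‖X - idxPoint q.1‖) ^ t)⁻¹ * ((1 + ‖X - idxPoint q.2‖) ^ t)⁻¹) := by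
  have hj := one_le_jbDiffIdx2 q.1 q.2
  set r := 1 + ‖X - midIdx2 d q.1 q.2‖
  have key : ∀ p : Idx2 d, ‖midIdx2 d q.1 q.2 - idxPoint p‖ ≤ jbDiffIdx2 d q.1 q.2 →
      1 + ‖X - idxPoint p‖ ≤ r * (2 * jbDiffIdx2 d q.1 q.2) := fun p hp ↦ by
    have h := one_add_norm_le_mul (X - idxPoint p) (X - midIdx2 d q.1 q.2)
    rw [sub_sub_sub_cancel_left] at h
    refine h.trans ?_
    gcongr
    linarith
  have h1 := pow_le_pow_left₀ (by positivity)
    (key q.1 (norm_midIdx2_sub_idxPoint_left_le q.1 q.2)) t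
  have h2 := pow_le_pow_left₀ (by positivity)
    (key q.2 (norm_midIdx2_sub_idxPoint_right_le q.1 q.2)) t
  rw [← mul_inv, ← div_eq_mul_inv, one_le_div (by positivity)]
  refine (mul_le_mul h1 h2 (by positivity) (by positivity)).trans_eq ?_
  rw [← mul_pow, ← mul_pow, pow_mul, ← sq, mul_pow]

theorem exists_norm_iteratedFDeriv_frame_term_le (hB : IsRegularMagneticField d B)
    (hg : IsWindow d g) (hM : IsTemperedWeightE4 d M) (k t : ℕ) :
    ∃ (C : ℝ) (m : ℕ), 0 ≤ C ∧ ∀ (N : Idx2 d × Idx2 d → ℂ) (D : ℝ),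
      (∀ q : Idx2 d × Idx2 d,
        jbDiffIdx2 d q.1 q.2 ^ m * (M (midIdx2 d q.1 q.2))⁻¹ * ‖N q‖ ≤ D) → ∀ q X,
      ‖iteratedFDeriv ℝ k (fun Y ↦ N q * frameTensor B g q Y) X‖ ≤ C * D * M X *
        (((1 + ‖X - idxPoint q.1‖) ^ t)⁻¹ * ((1 + ‖X - idxPoint q.2‖) ^ t)⁻¹) := by
  obtain ⟨CM, A, hCM, hA⟩ := hM.exists_le_mul
  obtain ⟨C, p, hC, hT⟩ := exists_norm_iteratedFDeriv_frameTensor_le hB hg k (2 * t + A)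
  refine ⟨C * 2 ^ (2 * t) * CM, p + 2 * t, by positivity, fun N D hN q X ↦ ?_⟩
  have hq := hN q
  have hTq := hT q X
  have hMq := hA (midIdx2 d q.1 q.2) X
  have hw := one_le_mul_inv_one_add_norm_sub_idxPoint X q t
  have hj := one_le_jbDiffIdx2 q.1 q.2
  have hMm := hM.1 (midIdx2 d q.1 q.2)
  have hMX := hM.1 X
  rw [norm_sub_rev] at hMq
  have hD : 0 ≤ D := le_trans (by positivity) hq
  have hD' : iteratedFDeriv ℝ k (fun Y ↦ N q * frameTensor B g q Y) X =
      N q • iteratedFDeriv ℝ k (frameTensor B g q) X := by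
    change iteratedFDeriv ℝ k (N q • frameTensor B g q) X = _
    exact iteratedFDeriv_const_smul_apply
      ((contDiff_frameTensor hB hg q).contDiffAt.of_le (by exact_mod_cast le_top))
  rw [hD', norm_smul]
  set r := 1 + ‖X - midIdx2 d q.1 q.2‖
  set j := jbDiffIdx2 d q.1 q.2
  set μ := M (midIdx2 d q.1 q.2)
  set τ := ‖iteratedFDeriv ℝ k (frameTensor B g q) X‖
  set w := ((1 + ‖X - idxPoint q.1‖) ^ t)⁻¹ * ((1 + ‖X - idxPoint q.2‖) ^ t)⁻¹
  have hr : 0 < r ^ A := by positivity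
  have hq' : j ^ (p + 2 * t) * ‖N q‖ ≤ D * μ := by
    have := mul_le_mul_of_nonneg_right hq hMm.le
    calc _ = j ^ (p + 2 * t) * μ⁻¹ * ‖N q‖ * μ := by field_simp
      _ ≤ _ := this
  have hw0 : 0 ≤ w := by positivity
  refine le_of_mul_le_mul_right ?_ hr
  calc ‖N q‖ * τ * r ^ A
      ≤ ‖N q‖ * τ * r ^ A * (r ^ (2 * t) * (2 * j) ^ (2 * t) * w) :=
        le_mul_of_one_le_right (by positivity) hw
    _ = ‖N q‖ * (r ^ (2 * t + A) * τ) * (2 * j) ^ (2 * t) * w := by ring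
    _ ≤ ‖N q‖ * (C * j ^ p) * (2 * j) ^ (2 * t) * w := by gcongr
    _ = C * 2 ^ (2 * t) * (j ^ (p + 2 * t) * ‖N q‖) * w := by rw [mul_pow, pow_add]; ring
    _ ≤ C * 2 ^ (2 * t) * (D * (CM * M X * r ^ A)) * w :=
        mul_le_mul_of_nonneg_right (mul_le_mul_of_nonneg_left
          (hq'.trans (mul_le_mul_of_nonneg_left hMq hD)) (by positivity)) hw0
    _ = _ := by ring

theorem hasSum_inv_one_add_norm_sub {t : ℕ} (ht : Summable fun p : Idx2 d ↦ ((1 + ‖p‖) ^ t)⁻¹)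
    (p₀ : Idx2 d) (c : ℝ) :
    HasSum (fun q : Idx2 d × Idx2 d ↦
      c * ((1 + ‖p₀ - q.1‖) ^ t)⁻¹ * (c * ((1 + ‖p₀ - q.2‖) ^ t)⁻¹))
      ((c * ∑' p : Idx2 d, ((1 + ‖p‖) ^ t)⁻¹) ^ 2) := by
  have h : HasSum (fun p : Idx2 d ↦ ((1 + ‖p₀ - p‖) ^ t)⁻¹) (∑' p : Idx2 d, ((1 + ‖p‖) ^ t)⁻¹) :=
    (Equiv.subLeft p₀).hasSum_iff.2 ht.hasSum
  have h2 := (h.mul h (h.summable.mul_of_nonneg h.summable (fun _ ↦ by positivity)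
    fun _ ↦ by positivity)).mul_left (c ^ 2)
  rw [← sq, ← mul_pow] at h2
  exact h2.congr_fun fun q ↦ by ring

/-- The super symbol assembled from a matrix by summing against the tensorised frame symbols. -/
def frameSeries (B : Fin d → Fin d → E1 d → ℝ) (g : E1 d → ℝ) (N : Idx2 d × Idx2 d → ℂ)
    (X : E4 d) : ℂ :=
  ∑' q, N q * frameTensor B g q X

/-- On every ball, each derivative of the frame series is dominated by a summable family. -/
theorem exists_summable_frame_bound (hB : IsRegularMagneticField d B) (hg : IsWindow d g)
    (hM : IsTemperedWeightE4 d M) {N : Idx2 d × Idx2 d → ℂ}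
    (hN : ∀ n : ℕ, ∃ C : ℝ, ∀ q : Idx2 d × Idx2 d,
      jbDiffIdx2 d q.1 q.2 ^ n * (M (midIdx2 d q.1 q.2))⁻¹ * ‖N q‖ ≤ C) :
    ∃ v : ℕ → ℝ → Idx2 d × Idx2 d → ℝ, (∀ k R, Summable (v k R)) ∧
      ∀ k R q X, ‖X‖ < R →
        ‖iteratedFDeriv ℝ k (fun Y ↦ N q * frameTensor B g q Y) X‖ ≤ v k R q := by
  obtain ⟨t, ht⟩ := exists_summable_one_add_norm_idx2 d
  obtain ⟨CM, A, hCM, hA⟩ := hM.exists_le_mul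
  choose C m hC h using fun k ↦ exists_norm_iteratedFDeriv_frame_term_le hB hg hM k t
  choose D hD using fun k ↦ hN (m k)
  refine ⟨fun k R q ↦ C k * D k * (CM * M 0 * (1 + R) ^ A) *
    ((1 + R) ^ t * ((1 + ‖(0 : Idx2 d) - q.1‖) ^ t)⁻¹ *
      ((1 + R) ^ t * ((1 + ‖(0 : Idx2 d) - q.2‖) ^ t)⁻¹)),
    fun k R ↦ (hasSum_inv_one_add_norm_sub ht 0 _).summable.mul_left _, fun k R q X hX ↦ ?_⟩
  refine (h k N (D k) (hD k) q X).trans ?_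
  have hD0 : 0 ≤ D k := by
    have := one_le_jbDiffIdx2 q.1 q.2
    have := hM.1 (midIdx2 d q.1 q.2)
    exact le_trans (by positivity) (hD k q)
  have hCk := hC k
  have h0 := hM.1 0
  have hXM := hA X 0
  rw [sub_zero] at hXM
  have hp : ∀ p : Idx2 d, ((1 + ‖X - idxPoint p‖) ^ t)⁻¹ ≤
      (1 + R) ^ t * ((1 + ‖(0 : Idx2 d) - p‖) ^ t)⁻¹ := fun p ↦ by
    have h' := inv_one_add_norm_sub_idxPoint_le X p 0 t
    have hz : idxPoint (0 : Idx2 d) = 0 := by simpa using idxPoint_sub (0 : Idx2 d) 0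
    rw [hz, sub_zero] at h'
    refine h'.trans ?_
    gcongr
  have hR : 0 ≤ R := (norm_nonneg X).trans hX.le
  dsimp only
  gcongr
  · exact hXM.trans (by gcongr)
  · exact hp q.1
  · exact hp q.2

theorem exists_norm_iteratedFDeriv_frameSeries_le (hB : IsRegularMagneticField d B)
    (hg : IsWindow d g) (hM : IsTemperedWeightE4 d M) (k : ℕ) :
    ∃ (C : ℝ) (m : ℕ), 0 ≤ C ∧ ∀ N : Idx2 d × Idx2 d → ℂ,
      (∀ n : ℕ, ∃ C : ℝ, ∀ q : Idx2 d × Idx2 d,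
        jbDiffIdx2 d q.1 q.2 ^ n * (M (midIdx2 d q.1 q.2))⁻¹ * ‖N q‖ ≤ C) → ∀ D : ℝ,
      (∀ q : Idx2 d × Idx2 d,
        jbDiffIdx2 d q.1 q.2 ^ m * (M (midIdx2 d q.1 q.2))⁻¹ * ‖N q‖ ≤ D) → ∀ X,
      ‖iteratedFDeriv ℝ k (frameSeries B g N) X‖ ≤ C * D * M X := by
  obtain ⟨t, ht⟩ := exists_summable_one_add_norm_idx2 d
  obtain ⟨C, m, hC, h⟩ := exists_norm_iteratedFDeriv_frame_term_le hB hg hM k t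
  set S := ∑' p : Idx2 d, ((1 + ‖p‖) ^ t)⁻¹
  refine ⟨C * (2 ^ t * S) ^ 2, m, by positivity, fun N hN D hD X ↦ ?_⟩
  obtain ⟨v, hv, hvb⟩ := exists_summable_frame_bound hB hg hM hN
  obtain ⟨p₀, hp₀⟩ := exists_norm_sub_idxPoint_le_one X
  have hD0 : 0 ≤ D := by
    have := one_le_jbDiffIdx2 (0 : Idx2 d) 0
    have := hM.1 (midIdx2 d 0 0)
    exact le_trans (by positivity) (hD (0, 0))
  have hMX := hM.1 X
  have hder := congrFun (iteratedFDeriv_tsum_of_ball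
    (fun q ↦ contDiff_const.mul (contDiff_frameTensor hB hg q)) hv hvb k) X
  have hp : ∀ p : Idx2 d, ((1 + ‖X - idxPoint p‖) ^ t)⁻¹ ≤
      2 ^ t * ((1 + ‖p₀ - p‖) ^ t)⁻¹ := fun p ↦ by
    refine (inv_one_add_norm_sub_idxPoint_le X p p₀ t).trans ?_
    gcongr
    linarith
  unfold frameSeries
  rw [hder]
  refine (tsum_of_norm_bounded ((hasSum_inv_one_add_norm_sub ht p₀ (2 ^ t)).mul_left
    (C * D * M X)) fun q ↦ (h N D hD q X).trans ?_).trans_eq (by ring)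
  gcongr
  · exact hp q.1
  · exact hp q.2

theorem s0Seminorm_le {Φ : E4 d → ℂ} (hM : ∀ X, 0 < M X) {k : ℕ} {C : ℕ → ℝ}
    (hC : ∀ i, 0 ≤ C i) (h : ∀ i ≤ k, ∀ X, ‖iteratedFDeriv ℝ i Φ X‖ ≤ C i * M X) :
    s0Seminorm d M k Φ ≤ ∑ i ∈ Finset.range (k + 1), C i :=
  Finset.sum_le_sum fun i hi ↦ Real.iSup_le (fun X ↦ (div_le_iff₀ (hM X)).2
    (h i (Finset.mem_range_succ_iff.1 hi) X)) (hC i)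

end FrameSeries

/-- matrices with off-diagonal decay relative to `M` dequantize to a
super symbol in `S₀(M)`: the frame series and all its term-wise derivatives converge
uniformly on compacts, the limit lies in `S₀(M)`, and its seminorms are controlled. -/
theorem statement15 (d : ℕ) (hd : 0 < d) (B : Fin d → Fin d → (Fin d → ℝ) → ℝ)
    (hB : IsRegularMagneticField d B) (g : (Fin d → ℝ) → ℝ) (hg : IsWindow d g)
    (M : E4 d → ℝ) (hM : IsTemperedWeightE4 d M)
    (N : Idx2 d × Idx2 d → ℂ)
    (hN : ∀ n : ℕ, ∃ C : ℝ, ∀ q : Idx2 d × Idx2 d,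
        jbDiffIdx2 d q.1 q.2 ^ n * (M (midIdx2 d q.1 q.2))⁻¹ * ‖N q‖ ≤ C) :
    ∃ Φ : E4 d → ℂ,
      (∀ (n : ℕ) (K : Set (E4 d)), IsCompact K →
        TendstoUniformlyOn
          (fun (s : Finset (Idx2 d × Idx2 d)) (X : E4 d) =>
            iteratedFDeriv ℝ n
              (fun Y : E4 d => ∑ q ∈ s,
                N q * deqSymbol d B g (q.1.1, q.2.1) Y.1 * deqSymbol d B g (q.2.2, q.1.2) Y.2) X)
          (iteratedFDeriv ℝ n Φ) Filter.atTop K) ∧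
      ContDiff ℝ (⊤ : ℕ∞) Φ ∧ InS0 d M Φ ∧
      (∀ k : ℕ, ∃ C > 0, ∃ n : ℕ, ∀ D : ℝ,
        (∀ q : Idx2 d × Idx2 d,
          jbDiffIdx2 d q.1 q.2 ^ n * (M (midIdx2 d q.1 q.2))⁻¹ * ‖N q‖ ≤ D) →
        s0Seminorm d M k Φ ≤ C * D) := by
  obtain ⟨v, hv, hvb⟩ := exists_summable_frame_bound hB hg hM hN
  have hterm := fun q ↦ contDiff_const (c := N q) |>.mul (contDiff_frameTensor hB hg q)
  have hsmooth : ContDiff ℝ (⊤ : ℕ∞) (frameSeries B g N) := contDiff_tsum_of_ball hterm hv hvb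
  choose C m hC h using exists_norm_iteratedFDeriv_frameSeries_le hB hg hM
  refine ⟨frameSeries B g N, fun n K hK ↦ ?_, hsmooth, ⟨hsmooth, fun n ↦ ?_⟩, fun k ↦ ?_⟩
  · simp only [mul_assoc]
    exact tendstoUniformlyOn_iteratedFDeriv_sum hterm hv hvb n hK
  · obtain ⟨D, hD⟩ := hN (m n)
    exact ⟨C n * D, h n N hN D hD⟩
  · have hCs : 0 ≤ ∑ i ∈ Finset.range (k + 1), C i := Finset.sum_nonneg fun i _ ↦ hC i
    refine ⟨1 + ∑ i ∈ Finset.range (k + 1), C i, by positivity,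
      ∑ i ∈ Finset.range (k + 1), m i, fun D hD ↦ ?_⟩
    have hpos : ∀ q : Idx2 d × Idx2 d, 0 ≤ (M (midIdx2 d q.1 q.2))⁻¹ * ‖N q‖ := fun q ↦ by
      have := hM.1 (midIdx2 d q.1 q.2)
      positivity
    have hD0 : 0 ≤ D := by
      have := one_le_jbDiffIdx2 (0 : Idx2 d) 0
      refine le_trans ?_ (hD (0, 0))
      rw [mul_assoc]
      exact mul_nonneg (by positivity) (hpos (0, 0))
    have hle := s0Seminorm_le (Φ := frameSeries B g N) hM.1 (k := k) (C := fun i ↦ C i * D)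
      (fun i ↦ mul_nonneg (hC i) hD0) fun i hi ↦ h i N hN D fun q ↦ by
        refine le_trans ?_ (hD q)
        rw [mul_assoc, mul_assoc]
        exact mul_le_mul_of_nonneg_right (pow_le_pow_right₀ (one_le_jbDiffIdx2 _ _)
          (Finset.single_le_sum (f := m) (fun _ _ ↦ Nat.zero_le _)
            (Finset.mem_range_succ_iff.2 hi))) (hpos q)
    rw [← Finset.sum_mul] at hle
    linarith
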